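/- arXiv:2110.02608 — 2 statements merged into one kernel-verified Lean document; each statement's English description precedes it below -/
import Mathlib

section
/- The equation x' = −x² + q(t)x + p(t) has either no hyperbolic solutions, or exactly two hyperbolic solutions; in the latter case the two hyperbolic solutions are the globally defined bounded solutions a (attractive) and r (repulsive) and they are uniformly separated. -/
open Set Filter

/-- The right-hand side of the quadratic equation `x' = -x² + Q(t)x + P(t)`. -/
def quadF (Q P : ℝ → ℝ) : ℝ → ℝ → ℝ := fun t x => -x ^ 2 + Q t * x + P t

/-- `b` is a globally defined bounded solution of `x' = -x² + Q(t)x + P(t)`. -/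
def IsBddSol (Q P b : ℝ → ℝ) : Prop :=
  (∀ t, HasDerivAt b (quadF Q P t (b t)) t) ∧ ∃ C, ∀ t, |b t| ≤ C

/-- `(k, β)` is a dichotomy constant pair witnessing that the variational equation
`z' = (-2 b(t) + Q(t)) z` is Hurwitz at `+∞` (attractive case). -/
def AttrDich (Q b : ℝ → ℝ) (k β : ℝ) : Prop :=
  1 ≤ k ∧ 0 < β ∧ ∀ s t : ℝ, s ≤ t →
    Real.exp (∫ l in s..t, (-2 * b l + Q l)) ≤ k * Real.exp (-β * (t - s))

/-- `(k, β)` is a dichotomy constant pair witnessing that the variational equation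
`z' = (-2 b(t) + Q(t)) z` is Hurwitz at `−∞` (repulsive case). -/
def RepDich (Q b : ℝ → ℝ) (k β : ℝ) : Prop :=
  1 ≤ k ∧ 0 < β ∧ ∀ s t : ℝ, t ≤ s →
    Real.exp (∫ l in s..t, (-2 * b l + Q l)) ≤ k * Real.exp (β * (t - s))

/-- `b` is an attractive hyperbolic solution of `x' = -x² + Q(t)x + P(t)`. -/
def IsAttrHyp (Q P b : ℝ → ℝ) : Prop := IsBddSol Q P b ∧ ∃ k β : ℝ, AttrDich Q b k β

/-- `b` is a repulsive hyperbolic solution of `x' = -x² + Q(t)x + P(t)`. -/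
def IsRepHyp (Q P b : ℝ → ℝ) : Prop := IsBddSol Q P b ∧ ∃ k β : ℝ, RepDich Q b k β

/-- `b` is a hyperbolic solution of `x' = -x² + Q(t)x + P(t)`. -/
def IsHyp (Q P b : ℝ → ℝ) : Prop := IsAttrHyp Q P b ∨ IsRepHyp Q P b

/-- The supremum norm distance between `f` and `g` is `< δ`. -/
def SupLt (f g : ℝ → ℝ) (δ : ℝ) : Prop := ∃ d : ℝ, d < δ ∧ ∀ t, |f t - g t| ≤ d

/-- The family of maximal solutions `t ↦ X t s x₀` of the scalar ODE `x' = h (t, x)`. -/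
structure MaxSolFamily (h : ℝ → ℝ → ℝ) where
  X : ℝ → ℝ → ℝ → ℝ
  dom : ℝ → ℝ → Set ℝ
  dom_open : ∀ s x₀, IsOpen (dom s x₀)
  dom_ordConn : ∀ s x₀, (dom s x₀).OrdConnected
  mem_dom : ∀ s x₀, s ∈ dom s x₀
  init : ∀ s x₀, X s s x₀ = x₀
  sol : ∀ s x₀, ∀ t ∈ dom s x₀, HasDerivAt (fun τ => X τ s x₀) (h t (X t s x₀)) t
  maximal : ∀ s x₀ (y : ℝ → ℝ) (I : Set ℝ), IsOpen I → I.OrdConnected → s ∈ I →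
      y s = x₀ → (∀ t ∈ I, HasDerivAt y (h t (y t)) t) →
      I ⊆ dom s x₀ ∧ ∀ t ∈ I, y t = X t s x₀

/-- The solution `X · s x₀` is (defined and) bounded as `t → −∞`. -/
def BddAtBot {h : ℝ → ℝ → ℝ} (F : MaxSolFamily h) (s x₀ : ℝ) : Prop :=
  ∃ C : ℝ, ∀ᶠ t in atBot, t ∈ F.dom s x₀ ∧ |F.X t s x₀| ≤ C

/-- The solution `X · s x₀` is (defined and) bounded as `t → ∞`. -/
def BddAtTop {h : ℝ → ℝ → ℝ} (F : MaxSolFamily h) (s x₀ : ℝ) : Prop :=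
  ∃ C : ℝ, ∀ᶠ t in atTop, t ∈ F.dom s x₀ ∧ |F.X t s x₀| ≤ C

/-- `a` is the globally defined bounded solution characterized by:
`X · s x₀` is bounded as `t → −∞` iff `x₀ ≤ a s`. -/
def CharA {h : ℝ → ℝ → ℝ} (F : MaxSolFamily h) (a : ℝ → ℝ) : Prop :=
  (∀ t, HasDerivAt a (h t (a t)) t) ∧ (∃ C, ∀ t, |a t| ≤ C) ∧
  ∀ s x₀ : ℝ, BddAtBot F s x₀ ↔ x₀ ≤ a s

/-- `r` is the globally defined bounded solution characterized by:
`X · s x₀` is bounded as `t → ∞` iff `x₀ ≥ r s`. -/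
def CharR {h : ℝ → ℝ → ℝ} (F : MaxSolFamily h) (r : ℝ → ℝ) : Prop :=
  (∀ t, HasDerivAt r (h t (r t)) t) ∧ (∃ C, ∀ t, |r t| ≤ C) ∧
  ∀ s x₀ : ℝ, BddAtTop F s x₀ ↔ r s ≤ x₀

/-- A continuous function on `ℝ` has a primitive that computes all its interval integrals. -/
lemma exists_primitive {f : ℝ → ℝ} (hf : Continuous f) :
    ∃ G : ℝ → ℝ, (∀ t, HasDerivAt G (f t) t) ∧ ∀ s t, ∫ l in s..t, f l = G t - G s := by
  have hG : ∀ t, HasDerivAt (fun t => ∫ l in (0 : ℝ)..t, f l) (f t) t := fun t =>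
    intervalIntegral.integral_hasDerivAt_right (hf.intervalIntegrable _ _)
      hf.aestronglyMeasurable.stronglyMeasurableAtFilter hf.continuousAt
  exact ⟨_, hG, fun s t => intervalIntegral.integral_eq_sub_of_hasDerivAt (fun x _ => hG x)
    (hf.intervalIntegrable _ _)⟩

lemma hasDerivAt_integral_Ioi {f : ℝ → ℝ} (hf : Continuous f)
    (hi : ∀ t, MeasureTheory.IntegrableOn f (Ioi t)) (t : ℝ) :
    HasDerivAt (fun t => ∫ x in Ioi t, f x) (-f t) t := by
  obtain ⟨G, hG, hGi⟩ := exists_primitive hf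
  have h : (fun t => ∫ x in Ioi t, f x) = fun t => (∫ x in Ioi (0 : ℝ), f x) - (G t - G 0) := by
    funext t
    rw [← hGi, ← intervalIntegral.integral_interval_add_Ioi (hi 0) (hi t)]
    ring
  rw [h]
  simpa using ((hG t).sub_const (G 0)).const_sub (∫ x in Ioi (0 : ℝ), f x)

lemma IsBddSol.continuous {Q P b : ℝ → ℝ} (hb : IsBddSol Q P b) : Continuous b :=
  continuous_iff_continuousAt.2 fun t => (hb.1 t).continuousAt

/-- The growth function of a solution under the time reversal `x(t) ↦ -x(-t)`. -/
lemma integral_reverse (Q b : ℝ → ℝ) (s t : ℝ) :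
    ∫ l in s..t, (-2 * -b (-l) + -Q (-l)) = ∫ l in (-s)..(-t), (-2 * b l + Q l) := by
  have h := intervalIntegral.integral_comp_neg (a := s) (b := t) fun l => -2 * b l + Q l
  rw [intervalIntegral.integral_symm (-t), ← h, ← intervalIntegral.integral_neg]
  congr 1
  funext l
  ring

lemma hasDerivAt_reverse {Q P b : ℝ → ℝ} {t : ℝ} (hb : HasDerivAt b (quadF Q P (-t) (b (-t))) (-t)) :
    HasDerivAt (fun t => -b (-t)) (quadF (fun t => -Q (-t)) (fun t => P (-t)) t (-b (-t))) t := by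
  have h := (hb.scomp t (hasDerivAt_neg t)).neg
  refine h.congr_deriv ?_
  simp [quadF]

lemma IsBddSol.reverse {Q P b : ℝ → ℝ} (hb : IsBddSol Q P b) :
    IsBddSol (fun t => -Q (-t)) (fun t => P (-t)) (fun t => -b (-t)) := by
  obtain ⟨h, C, hC⟩ := hb
  exact ⟨fun t => hasDerivAt_reverse (h (-t)), C, fun t => by simpa using hC (-t)⟩

lemma IsAttrHyp.reverse {Q P b : ℝ → ℝ} (hb : IsAttrHyp Q P b) :
    IsRepHyp (fun t => -Q (-t)) (fun t => P (-t)) (fun t => -b (-t)) := by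
  obtain ⟨h, k, β, hk, hβ, hd⟩ := hb
  refine ⟨h.reverse, k, β, hk, hβ, fun s t hst => ?_⟩
  rw [integral_reverse]
  convert hd (-s) (-t) (by linarith) using 3
  ring

lemma IsRepHyp.reverse {Q P b : ℝ → ℝ} (hb : IsRepHyp Q P b) :
    IsAttrHyp (fun t => -Q (-t)) (fun t => P (-t)) (fun t => -b (-t)) := by
  obtain ⟨h, k, β, hk, hβ, hd⟩ := hb
  refine ⟨h.reverse, k, β, hk, hβ, fun s t hst => ?_⟩
  rw [integral_reverse]
  convert hd (-s) (-t) (by linarith) using 3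
  ring

/-- A solution that is bounded at `-∞` lies below every attractive hyperbolic solution. -/
lemma IsAttrHyp.le_of_bdd_atBot {Q P a x : ℝ → ℝ} {s C : ℝ} (ha : IsAttrHyp Q P a)
    (hQ : Continuous Q) (hx : ∀ t ≤ s, HasDerivAt x (quadF Q P t (x t)) t)
    (hC : ∀ᶠ t in atBot, |x t| ≤ C) : x s ≤ a s := by
  have hac := ha.1.continuous
  obtain ⟨⟨ha', A, hA⟩, k, β, hk, hβ, hd⟩ := ha
  obtain ⟨G, hG, hGi⟩ := exists_primitive (f := fun l => -2 * a l + Q l) (by fun_prop)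
  have hD : ∀ t ≤ s, HasDerivAt (fun t => (x t - a t) * Real.exp (-G t))
      (-(x t - a t) ^ 2 * Real.exp (-G t)) t := fun t ht => by
    refine (((hx t ht).sub (ha' t)).mul (hG t).neg.exp).congr_deriv ?_
    simp only [quadF, Pi.sub_apply, Pi.neg_apply]
    ring
  have hint : ∀ t ∈ interior (Iic s), t ≤ s := fun t ht => interior_subset (s := Iic s) ht
  have hanti : AntitoneOn (fun t => (x t - a t) * Real.exp (-G t)) (Iic s) := by
    refine antitoneOn_of_deriv_nonpos (convex_Iic s)
      (fun t ht => (hD t ht).continuousAt.continuousWithinAt)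
      (fun t ht => (hD t (hint t ht)).differentiableAt.differentiableWithinAt)
      fun t ht => ?_
    rw [(hD t (hint t ht)).deriv]
    nlinarith [sq_nonneg (x t - a t), Real.exp_pos (-G t)]
  have hbound : ∀ᶠ t in atBot, x s - a s ≤ (C + A) * (k * Real.exp (-β * (s - t))) := by
    filter_upwards [hC, eventually_le_atBot s] with t htC hts
    have h1 : (x s - a s) * Real.exp (-G s) ≤ (x t - a t) * Real.exp (-G t) :=
      hanti hts (mem_Iic.2 le_rfl) hts
    have h2 := hd t s hts
    rw [hGi] at h2
    have h3 : x s - a s ≤ (x t - a t) * Real.exp (G s - G t) := by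
      have := mul_le_mul_of_nonneg_right h1 (Real.exp_pos (G s)).le
      rwa [mul_assoc, mul_assoc, ← Real.exp_add, ← Real.exp_add, neg_add_cancel, Real.exp_zero,
        mul_one, neg_add_eq_sub] at this
    have h4 : x t - a t ≤ C + A := by
      linarith [(abs_le.1 htC).2, (abs_le.1 (hA t)).1]
    have h5 : 0 ≤ C + A := by linarith [abs_nonneg (x t), abs_nonneg (a t), hA t]
    calc _ ≤ _ := h3
      _ ≤ (C + A) * Real.exp (G s - G t) := by gcongr
      _ ≤ _ := by gcongr
  have hlim : Tendsto (fun t => (C + A) * (k * Real.exp (-β * (s - t)))) atBot (nhds 0) := by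
    have h1 : Tendsto (fun t => -β * (s - t)) atBot atBot := by
      have := (tendsto_atBot_add_const_left atBot (-β * s) (tendsto_id.const_mul_atBot hβ))
      refine this.congr fun t => ?_
      simp only [id]
      ring
    simpa using ((Real.tendsto_exp_atBot.comp h1).const_mul k).const_mul (C + A)
  linarith [ge_of_tendsto hlim hbound]

/-- A solution that is bounded at `+∞` lies above every repulsive hyperbolic solution. -/
lemma IsRepHyp.le_of_bdd_atTop {Q P r x : ℝ → ℝ} {s C : ℝ} (hr : IsRepHyp Q P r)
    (hQ : Continuous Q) (hx : ∀ t, s ≤ t → HasDerivAt x (quadF Q P t (x t)) t)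
    (hC : ∀ᶠ t in atTop, |x t| ≤ C) : r s ≤ x s := by
  have h := hr.reverse.le_of_bdd_atBot (s := -s) (x := fun t => -x (-t)) (C := C) (by fun_prop)
    (fun t ht => hasDerivAt_reverse (hx (-t) (by linarith)))
    ((tendsto_neg_atBot_atTop.eventually hC).mono fun t ht => by simpa using ht)
  simpa using h

lemma IsAttrHyp.eq {Q P a b : ℝ → ℝ} (ha : IsAttrHyp Q P a) (hb : IsAttrHyp Q P b)
    (hQ : Continuous Q) : a = b := by
  obtain ⟨A, hA⟩ := ha.1.2
  obtain ⟨B, hB⟩ := hb.1.2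
  funext s
  exact le_antisymm (hb.le_of_bdd_atBot hQ (fun t _ => ha.1.1 t) (Eventually.of_forall hA))
    (ha.le_of_bdd_atBot hQ (fun t _ => hb.1.1 t) (Eventually.of_forall hB))

lemma IsRepHyp.eq {Q P a b : ℝ → ℝ} (ha : IsRepHyp Q P a) (hb : IsRepHyp Q P b)
    (hQ : Continuous Q) : a = b := by
  obtain ⟨A, hA⟩ := ha.1.2
  obtain ⟨B, hB⟩ := hb.1.2
  funext s
  exact le_antisymm (ha.le_of_bdd_atTop hQ (fun t _ => hb.1.1 t) (Eventually.of_forall hB))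
    (hb.le_of_bdd_atTop hQ (fun t _ => ha.1.1 t) (Eventually.of_forall hA))

/-- Every initial value below the upper one of two ordered bounded solutions starts a solution
that is defined and bounded on a left half-line. -/
lemma exists_bdd_sol_Iic {Q P a r : ℝ → ℝ} (ha : IsBddSol Q P a) (hr : IsBddSol Q P r)
    (hra : ∀ t, r t < a t) {s x₀ : ℝ} (hx₀ : x₀ ≤ a s) :
    ∃ (x : ℝ → ℝ) (ε C : ℝ), 0 < ε ∧ x s = x₀ ∧
      (∀ t < s + ε, HasDerivAt x (quadF Q P t (x t)) t) ∧ ∀ t ≤ s, |x t| ≤ C := by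
  have hac := ha.continuous
  have hrc := hr.continuous
  obtain ⟨ha', A, hA⟩ := ha
  obtain ⟨hr', R, hR⟩ := hr
  rcases hx₀.eq_or_lt with rfl | hlt
  · exact ⟨a, 1, A, one_pos, rfl, fun t _ => ha' t, fun t _ => hA t⟩
  obtain ⟨W, hW, -⟩ := exists_primitive (f := fun l => a l - r l) (by fun_prop)
  have hWmono : Monotone W := monotone_of_deriv_nonneg (fun t => (hW t).differentiableAt)
    fun t => by rw [(hW t).deriv]; linarith [hra t]
  set m₀ := (x₀ - r s) / (x₀ - a s) with hm₀
  set e : ℝ → ℝ := fun t => 1 - m₀ * Real.exp (W t - W s) with he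
  have hne : x₀ - a s < 0 := by linarith
  have hm₀_lt : m₀ < 1 := by
    rw [hm₀, div_lt_one_of_neg hne]
    linarith [hra s]
  set c := 1 - max m₀ 0 with hc
  have hc0 : 0 < c := by
    rw [hc, sub_pos]
    exact max_lt hm₀_lt one_pos
  have hce : ∀ t ≤ s, c ≤ e t := fun t ht => by
    have h1 : Real.exp (W t - W s) ≤ 1 := Real.exp_le_one_iff.2 (sub_nonpos.2 (hWmono ht))
    have h2 := Real.exp_pos (W t - W s)
    have h3 : m₀ * Real.exp (W t - W s) ≤ max m₀ 0 := by
      nlinarith [le_max_left m₀ 0, le_max_right m₀ 0]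
    simp only [hc, he]
    linarith
  have he' : ∀ t, HasDerivAt e ((e t - 1) * (a t - r t)) t := fun t => by
    refine ((((hW t).sub_const (W s)).exp.const_mul m₀).const_sub 1).congr_deriv ?_
    simp only [he]
    ring
  have hpos : ∀ᶠ t in nhds s, 0 < e t :=
    (he' s).continuousAt.eventually (lt_mem_nhds (hc0.trans_le (hce s le_rfl)))
  obtain ⟨ε, hε, hball⟩ := Metric.eventually_nhds_iff.1 hpos
  have hepos : ∀ t < s + ε, 0 < e t := fun t ht => by
    rcases le_total t s with hts | hts
    · exact hc0.trans_le (hce t hts)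
    · refine hball ?_
      rw [Real.dist_eq, abs_of_nonneg (by linarith)]
      linarith
  refine ⟨fun t => a t - (a t - r t) / e t, ε, A + (A + R) / c, hε, ?_, fun t ht => ?_,
    fun t ht => ?_⟩
  · have : e s = (r s - a s) / (x₀ - a s) := by
      simp only [he, sub_self, Real.exp_zero, mul_one, hm₀]
      field_simp [hne.ne]
      ring
    have h2 : r s - a s ≠ 0 := (sub_neg.2 (hra s)).ne
    simp only [this]
    have := hne.ne
    field_simp
    ring
  · have h0 := (hepos t ht).ne'
    refine ((ha' t).sub (((ha' t).sub (hr' t)).div (he' t) h0)).congr_deriv ?_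
    simp only [quadF, Pi.sub_apply]
    field_simp
    ring
  · have h1 := hce t ht
    have h2 : |(a t - r t) / e t| ≤ (A + R) / c := by
      rw [abs_div, abs_of_pos (hc0.trans_le h1)]
      have h3 : |a t - r t| ≤ A + R := (abs_sub _ _).trans (add_le_add (hA t) (hR t))
      exact div_le_div₀ ((abs_nonneg _).trans h3) h3 hc0 h1
    exact (abs_sub _ _).trans (add_le_add (hA t) h2)

/-- Every initial value above the lower one of two ordered bounded solutions starts a solution
that is defined and bounded on a right half-line. -/
lemma exists_bdd_sol_Ici {Q P a r : ℝ → ℝ} (ha : IsBddSol Q P a) (hr : IsBddSol Q P r)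
    (hra : ∀ t, r t < a t) {s x₀ : ℝ} (hx₀ : r s ≤ x₀) :
    ∃ (x : ℝ → ℝ) (ε C : ℝ), 0 < ε ∧ x s = x₀ ∧
      (∀ t > s - ε, HasDerivAt x (quadF Q P t (x t)) t) ∧ ∀ t ≥ s, |x t| ≤ C := by
  obtain ⟨x, ε, C, hε, hxs, hx, hC⟩ := exists_bdd_sol_Iic hr.reverse ha.reverse
    (fun t => neg_lt_neg (hra (-t))) (s := -s) (x₀ := -x₀) (by simpa using hx₀)
  refine ⟨fun t => -x (-t), ε, C, hε, by simp [hxs], fun t ht => ?_, fun t ht => ?_⟩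
  · simpa using hasDerivAt_reverse (hx (-t) (by linarith))
  · simpa using hC (-t) (by linarith)

/-- An attractive hyperbolic solution `a` comes with a repulsive one: with a primitive `G` of
`-2a + Q`, it is `a - w`, where `w(t) = exp (G t) / ∫ l in Ioi t, exp (G l)`. -/
lemma IsAttrHyp.exists_isRepHyp {Q P a : ℝ → ℝ} (ha : IsAttrHyp Q P a) (hQ : Continuous Q)
    (hQb : ∃ C, ∀ t, |Q t| ≤ C) :
    ∃ r, IsRepHyp Q P r ∧ ∃ δ > 0, ∀ t, δ ≤ a t - r t := by
  have hac := ha.1.continuous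
  obtain ⟨⟨ha', A, hA⟩, k, β, hk, hβ, hd⟩ := ha
  obtain ⟨B, hB⟩ := hQb
  obtain ⟨G, hG, hGi⟩ := exists_primitive (f := fun l => -2 * a l + Q l) (by fun_prop)
  have hGc : Continuous G := continuous_iff_continuousAt.2 fun t => (hG t).continuousAt
  have hk0 : 0 < k := by linarith
  set M := 2 * A + B + 1 with hM
  have hM0 : 0 < M := by linarith [(abs_nonneg _).trans (hA 0), (abs_nonneg _).trans (hB 0)]
  have hup : ∀ t l, t ≤ l → Real.exp (G l) ≤ k * Real.exp (G t + β * t) * Real.exp (-β * l) :=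
    fun t l htl => by
      have h := hd t l htl
      rw [hGi] at h
      calc Real.exp (G l) = Real.exp (G t) * Real.exp (G l - G t) := by
            rw [← Real.exp_add]; congr 1; ring
        _ ≤ Real.exp (G t) * (k * Real.exp (-β * (l - t))) := by gcongr
        _ = k * (Real.exp (G t) * Real.exp (-β * (l - t))) := by ring
        _ = _ := by rw [mul_assoc, ← Real.exp_add, ← Real.exp_add]; congr 2; ring
  have hGM : Monotone fun t => G t + M * t := by
    have h : ∀ t, HasDerivAt (fun t => G t + M * t) (-2 * a t + Q t + M) t := fun t => by
      exact ((hG t).add ((hasDerivAt_id t).const_mul M)).congr_deriv (by simp)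
    refine monotone_of_deriv_nonneg (fun t => (h t).differentiableAt) fun t => ?_
    rw [(h t).deriv]
    linarith [(abs_le.1 (hA t)).2, (abs_le.1 (hB t)).1]
  have hlow : ∀ t l, t ≤ l → Real.exp (G t + M * t) * Real.exp (-M * l) ≤ Real.exp (G l) :=
    fun t l htl => by
      rw [← Real.exp_add, Real.exp_le_exp]
      have : G t + M * t ≤ G l + M * l := hGM htl
      linarith
  have hiβ : ∀ t, MeasureTheory.IntegrableOn
      (fun l => k * Real.exp (G t + β * t) * Real.exp (-β * l)) (Ioi t) := fun t =>
    (integrableOn_exp_mul_Ioi (neg_lt_zero.2 hβ) t).const_mul _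
  have hiM : ∀ t, MeasureTheory.IntegrableOn
      (fun l => Real.exp (G t + M * t) * Real.exp (-M * l)) (Ioi t) := fun t =>
    (integrableOn_exp_mul_Ioi (neg_lt_zero.2 hM0) t).const_mul _
  have hi : ∀ t, MeasureTheory.IntegrableOn (fun l => Real.exp (G l)) (Ioi t) := fun t => by
    refine (hiβ t).mono' (by fun_prop : Continuous fun l => Real.exp (G l)).aestronglyMeasurable ?_
    filter_upwards [MeasureTheory.ae_restrict_mem measurableSet_Ioi] with l hl
    rw [Real.norm_eq_abs, Real.abs_exp]
    exact hup t l (le_of_lt hl)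
  set z : ℝ → ℝ := fun t => ∫ l in Ioi t, Real.exp (G l) with hz
  have hz' : ∀ t, HasDerivAt z (-Real.exp (G t)) t :=
    hasDerivAt_integral_Ioi (by fun_prop) hi
  have hexp_integral : ∀ (t γ : ℝ), 0 < γ → ∀ c,
      ∫ l in Ioi t, c * Real.exp (G t + γ * t) * Real.exp (-γ * l) = c * Real.exp (G t) / γ :=
    fun t γ hγ c => by
      rw [MeasureTheory.integral_const_mul, integral_exp_mul_Ioi (neg_lt_zero.2 hγ), neg_div_neg_eq,
        mul_div_assoc', mul_assoc, ← Real.exp_add]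
      congr 3
      ring
  have hzup : ∀ t, z t ≤ k * Real.exp (G t) / β := fun t => by
    rw [← hexp_integral t β hβ k]
    exact MeasureTheory.setIntegral_mono_on (hi t) (hiβ t) measurableSet_Ioi
      fun l hl => hup t l (le_of_lt hl)
  have hzlow : ∀ t, Real.exp (G t) / M ≤ z t := fun t => by
    have h := hexp_integral t M hM0 1
    simp only [one_mul] at h
    rw [← h]
    exact MeasureTheory.setIntegral_mono_on (hiM t) (hi t) measurableSet_Ioi
      fun l hl => hlow t l (le_of_lt hl)
  have hz0 : ∀ t, 0 < z t := fun t => (div_pos (Real.exp_pos _) hM0).trans_le (hzlow t)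
  set w : ℝ → ℝ := fun t => Real.exp (G t) / z t with hw
  have hw_le : ∀ t, w t ≤ M := fun t => by
    have := hzlow t
    rw [div_le_iff₀ hM0] at this
    rw [hw, div_le_iff₀ (hz0 t)]
    linarith
  have hw_ge : ∀ t, β / k ≤ w t := fun t => by
    have := hzup t
    rw [le_div_iff₀ hβ] at this
    rw [hw, div_le_div_iff₀ hk0 (hz0 t)]
    linarith
  have hδ : 0 < β / k := div_pos hβ hk0
  have hw' : ∀ t, HasDerivAt w ((-2 * a t + Q t) * w t + w t ^ 2) t := fun t => by
    refine ((hG t).exp.div (hz' t) (hz0 t).ne').congr_deriv ?_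
    have := (hz0 t).ne'
    simp only [hw]
    field_simp
    ring
  have hwc : Continuous w := continuous_iff_continuousAt.2 fun t => (hw' t).continuousAt
  have hwpos : ∀ t, 0 < w t := fun t => hδ.trans_le (hw_ge t)
  refine ⟨fun t => a t - w t, ⟨⟨fun t => ?_, A + M, fun t => ?_⟩,
    max 1 ((M / (β / k)) ^ 2 * k), β, le_max_left _ _, hβ, fun s t hts => ?_⟩, β / k, hδ,
    fun t => ?_⟩
  · refine ((ha' t).sub (hw' t)).congr_deriv ?_
    simp only [quadF]
    ring
  · refine (abs_sub _ _).trans (add_le_add (hA t) ?_)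
    rw [abs_of_pos (hwpos t)]
    exact hw_le t
  · have hprim : ∀ l, HasDerivAt (fun l => 2 * Real.log (w l) - G l)
        (-2 * (a l - w l) + Q l) l := fun l => by
      refine ((((hw' l).log (hwpos l).ne').const_mul 2).sub (hG l)).congr_deriv ?_
      have := (hwpos l).ne'
      field_simp
      ring
    rw [intervalIntegral.integral_eq_sub_of_hasDerivAt (fun l _ => hprim l)
      ((by fun_prop : Continuous fun l => -2 * (a l - w l) + Q l).intervalIntegrable _ _)]
    have h1 := hd t s hts
    rw [hGi] at h1
    have h2 : Real.exp (2 * Real.log (w t) - G t - (2 * Real.log (w s) - G s))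
        = (w t / w s) ^ 2 * Real.exp (G s - G t) := by
      rw [← Real.exp_log (div_pos (hwpos t) (hwpos s)), ← Real.exp_nat_mul, ← Real.exp_add,
        Real.log_div (hwpos t).ne' (hwpos s).ne']
      congr 1
      push_cast
      ring
    have h3 : w t / w s ≤ M / (β / k) := div_le_div₀ hM0.le (hw_le t) hδ (hw_ge s)
    have h4 : 0 ≤ w t / w s := (div_pos (hwpos t) (hwpos s)).le
    rw [h2]
    calc (w t / w s) ^ 2 * Real.exp (G s - G t)
        ≤ (M / (β / k)) ^ 2 * (k * Real.exp (-β * (s - t))) := by gcongr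
      _ = (M / (β / k)) ^ 2 * k * Real.exp (β * (t - s)) := by
          rw [mul_assoc]; congr 3; ring
      _ ≤ _ := by gcongr; exact le_max_right _ _
  · simpa using hw_ge t

lemma IsRepHyp.exists_isAttrHyp {Q P r : ℝ → ℝ} (hr : IsRepHyp Q P r) (hQ : Continuous Q)
    (hQb : ∃ C, ∀ t, |Q t| ≤ C) :
    ∃ a, IsAttrHyp Q P a ∧ ∃ δ > 0, ∀ t, δ ≤ a t - r t := by
  obtain ⟨C, hC⟩ := hQb
  obtain ⟨x, hx, δ, hδ, h⟩ := hr.reverse.exists_isRepHyp (by fun_prop)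
    ⟨C, fun t => by simpa using hC (-t)⟩
  refine ⟨fun t => -x (-t), by simpa using hx.reverse, δ, hδ, fun t => ?_⟩
  have := h (-t)
  rw [neg_neg] at this
  linarith

lemma IsAttrHyp.charA {Q P a r : ℝ → ℝ} (F : MaxSolFamily (quadF Q P)) (ha : IsAttrHyp Q P a)
    (hr : IsBddSol Q P r) (hra : ∀ t, r t < a t) (hQ : Continuous Q) : CharA F a := by
  refine ⟨ha.1.1, ha.1.2, fun s x₀ => ⟨fun ⟨C, hC⟩ => ?_, fun h => ?_⟩⟩
  · have hdom : ∀ t ≤ s, t ∈ F.dom s x₀ := fun t ht => by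
      obtain ⟨τ, hτ, hτt⟩ := (hC.and (eventually_le_atBot t)).exists
      exact (F.dom_ordConn s x₀).out hτ.1 (F.mem_dom s x₀) ⟨hτt, ht⟩
    simpa [F.init] using ha.le_of_bdd_atBot (x := fun τ => F.X τ s x₀) (s := s) hQ
      (fun t ht => F.sol s x₀ t (hdom t ht)) (hC.mono fun t ht => ht.2)
  · obtain ⟨x, ε, C, hε, hxs, hx, hxC⟩ := exists_bdd_sol_Iic ha.1 hr hra h
    obtain ⟨hsub, heq⟩ := F.maximal s x₀ x (Iio (s + ε)) isOpen_Iio ordConnected_Iio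
      (by simpa using hε) hxs hx
    refine ⟨C, (eventually_le_atBot s).mono fun t ht => ?_⟩
    have htI : t ∈ Iio (s + ε) := by simp only [mem_Iio]; linarith
    exact ⟨hsub htI, heq t htI ▸ hxC t ht⟩

lemma IsRepHyp.charR {Q P a r : ℝ → ℝ} (F : MaxSolFamily (quadF Q P)) (hr : IsRepHyp Q P r)
    (ha : IsBddSol Q P a) (hra : ∀ t, r t < a t) (hQ : Continuous Q) : CharR F r := by
  refine ⟨hr.1.1, hr.1.2, fun s x₀ => ⟨fun ⟨C, hC⟩ => ?_, fun h => ?_⟩⟩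
  · have hdom : ∀ t, s ≤ t → t ∈ F.dom s x₀ := fun t ht => by
      obtain ⟨τ, hτ, hτt⟩ := (hC.and (eventually_ge_atTop t)).exists
      exact (F.dom_ordConn s x₀).out (F.mem_dom s x₀) hτ.1 ⟨ht, hτt⟩
    simpa [F.init] using hr.le_of_bdd_atTop (x := fun τ => F.X τ s x₀) (s := s) hQ
      (fun t ht => F.sol s x₀ t (hdom t ht)) (hC.mono fun t ht => ht.2)
  · obtain ⟨x, ε, C, hε, hxs, hx, hxC⟩ := exists_bdd_sol_Ici ha hr.1 hra h
    obtain ⟨hsub, heq⟩ := F.maximal s x₀ x (Ioi (s - ε)) isOpen_Ioi ordConnected_Ioi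
      (by simpa using hε) hxs hx
    refine ⟨C, (eventually_ge_atTop s).mono fun t ht => ?_⟩
    have htI : t ∈ Ioi (s - ε) := by simp only [mem_Ioi]; linarith
    exact ⟨hsub htI, heq t htI ▸ hxC t ht⟩

theorem stmt15 (q p : ℝ → ℝ)
    (hqb : ∃ C, ∀ t, |q t| ≤ C) (hqu : UniformContinuous q)
    (hpb : ∃ C, ∀ t, |p t| ≤ C) (hpu : UniformContinuous p)
    (F : MaxSolFamily (quadF q p)) :
    -- either no hyperbolic solutions at all ...
    (∀ b : ℝ → ℝ, ¬ IsHyp q p b) ∨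
    -- ... or exactly two: a (attractive) and r (repulsive), uniformly separated
    (∃ a r : ℝ → ℝ, CharA F a ∧ CharR F r ∧
      IsAttrHyp q p a ∧ IsRepHyp q p r ∧ a ≠ r ∧
      (∃ δ > (0:ℝ), ∀ t, δ ≤ a t - r t) ∧
      (∀ b : ℝ → ℝ, IsHyp q p b → b = a ∨ b = r)) := by
  by_cases hex : ∃ b, IsHyp q p b
  · right
    have hq := hqu.continuous
    obtain ⟨a, r, ha, hr, δ, hδ, har⟩ : ∃ a r, IsAttrHyp q p a ∧ IsRepHyp q p r ∧
        ∃ δ > (0 : ℝ), ∀ t, δ ≤ a t - r t := by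
      obtain ⟨b, hb | hb⟩ := hex
      · obtain ⟨r, hr, h⟩ := hb.exists_isRepHyp hq hqb
        exact ⟨b, r, hb, hr, h⟩
      · obtain ⟨a, ha, h⟩ := hb.exists_isAttrHyp hq hqb
        exact ⟨a, b, ha, hb, h⟩
    have hra : ∀ t, r t < a t := fun t => by linarith [har t]
    refine ⟨a, r, ha.charA F hr.1 hra hq, hr.charR F ha.1 hra hq, ha, hr,
      fun h => (hra 0).ne' (congrFun h 0), ⟨δ, hδ, har⟩, fun b hb => ?_⟩
    exact hb.imp (fun h => h.eq ha hq) fun h => h.eq hr hq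
  · exact Or.inl fun b hb => hex ⟨b, hb⟩
end

section
/- Assume the equation x' = −x² + p(t) has exactly two hyperbolic solutions ã and r̃ (with r̃ < ã), and let c > 0. Suppose the solutions a_c and r_c of x' = −x² + p(t) − q_c(t) are globally defined and bounded. Then r̃(t) < r_c(t) ≤ a_c(t) < ã(t) for all t ∈ ℝ. If in addition a_c ≠ r_c, then lim_{t→∞}|ã(t) − a_c(t)| = 0 and lim_{t→−∞}|r̃(t) − r_c(t)| = 0; moreover inf_{t∈ℝ}(a_c(t) − r_c(t)) > 0, a_c and r_c are hyperbolic solutions of x' = −x² + p(t) − q_c(t), and λ*(0, p − q_c) < 0. Consequently, if λ*(0, p − q_c) = 0, then x' = −x² + p(t) − q_c(t) has exactly one globally defined bounded solution. -/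
open Set Filter

/-- `q_c(t) = 2c/(π(c²t²+1))`. -/
noncomputable def qc (c : ℝ) : ℝ → ℝ := fun t => 2 * c / (Real.pi * (c ^ 2 * t ^ 2 + 1))

/-- Two solutions of the same Riccati equation differ by a solution of a linear equation. -/
theorem hasDerivAt_sub_of_riccati {P a r : ℝ → ℝ}
    (ha : ∀ t, HasDerivAt a (-(a t) ^ 2 + P t) t) (hr : ∀ t, HasDerivAt r (-(r t) ^ 2 + P t) t)
    (t : ℝ) : HasDerivAt (fun τ => a τ - r τ) (-(a t + r t) * (a t - r t)) t := by
  refine ((ha t).sub (hr t)).congr_deriv ?_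
  ring

/-- The substitution `(t, x) ↦ (-t, -x)` reverses time in the Riccati equation. -/
theorem hasDerivAt_neg_comp_neg_of_riccati {P b : ℝ → ℝ}
    (hb : ∀ t, HasDerivAt b (-(b t) ^ 2 + P t) t) (t : ℝ) :
    HasDerivAt (fun τ => -b (-τ)) (-(-b (-t)) ^ 2 + P (-t)) t := by
  have h := ((hb (-t)).comp t (hasDerivAt_neg t)).neg
  refine h.congr_deriv ?_
  ring

theorem eq_mul_exp_integral {z g : ℝ → ℝ} (hg : Continuous g)
    (hz : ∀ t, HasDerivAt z (g t * z t) t) (s t : ℝ) :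
    z t = z s * Real.exp (∫ l in s..t, g l) := by
  have hI : ∀ τ, HasDerivAt (fun τ => ∫ l in s..τ, g l) (g τ) τ := fun τ =>
    (hg.integral_hasStrictDerivAt s τ).hasDerivAt
  have hc : ∀ τ, HasDerivAt (fun τ => z τ * Real.exp (-∫ l in s..τ, g l)) 0 τ := fun τ => by
    refine ((hz τ).mul (hI τ).neg.exp).congr_deriv ?_
    ring
  have h := is_const_of_deriv_eq_zero (fun τ => (hc τ).differentiableAt)
    (fun τ => (hc τ).deriv) t s
  simp only [intervalIntegral.integral_same, neg_zero, Real.exp_zero, mul_one] at h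
  rw [← h, mul_assoc, ← Real.exp_add]
  simp

/-- A function whose derivative is eventually bounded below by a positive constant is unbounded
above. -/
theorem not_bddAbove_of_deriv_ge {m m' : ℝ → ℝ} {T η : ℝ} (hη : 0 < η)
    (hm : ∀ t, HasDerivAt m (m' t) t) (hm' : ∀ t, T ≤ t → η ≤ m' t) (K : ℝ) :
    ∃ t, T ≤ t ∧ K < m t := by
  have hmono : MonotoneOn (fun t => m t - η * t) (Ici T) := by
    have hd : ∀ t, HasDerivAt (fun t => m t - η * t) (m' t - η * 1) t := fun t =>
      (hm t).sub ((hasDerivAt_id t).const_mul η)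
    refine monotoneOn_of_deriv_nonneg (convex_Ici T)
      (fun t _ => (hd t).continuousAt.continuousWithinAt)
      (fun t _ => (hd t).differentiableAt.differentiableWithinAt) fun t ht => ?_
    rw [interior_Ici] at ht
    rw [(hd t).deriv]
    linarith [hm' t ht.le]
  refine ⟨T + (|K - m T| + 1) / η, ?_, ?_⟩
  · have : 0 ≤ (|K - m T| + 1) / η := by positivity
    linarith
  · have h0 : 0 ≤ (|K - m T| + 1) / η := by positivity
    have h := hmono self_mem_Ici (show T + (|K - m T| + 1) / η ∈ Ici T by
      simpa using h0) (by linarith)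
    simp only [mul_add, mul_div_cancel₀ _ hη.ne'] at h
    linarith [le_abs_self (K - m T)]

/-- If `x` solves the Riccati equation with forcing `p - q` and `u < v` solve it with forcing `p`,
then `(x - u) / (v - u)` solves a perturbed logistic equation. -/
theorem hasDerivAt_div_logistic {p q u v x : ℝ → ℝ}
    (hu : ∀ t, HasDerivAt u (-(u t) ^ 2 + p t) t) (hv : ∀ t, HasDerivAt v (-(v t) ^ 2 + p t) t)
    (huv : ∀ t, u t < v t) (hx : ∀ t, HasDerivAt x (-(x t) ^ 2 + (p t - q t)) t) (t : ℝ) :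
    HasDerivAt (fun τ => (x τ - u τ) / (v τ - u τ))
      ((v t - u t) * ((x t - u t) / (v t - u t)) * (1 - (x t - u t) / (v t - u t))
        - q t / (v t - u t)) t := by
  have h0 : v t - u t ≠ 0 := (sub_pos.2 (huv t)).ne'
  refine (((hx t).sub (hu t)).div ((hv t).sub (hu t)) h0).congr_deriv ?_
  simp only [Pi.sub_apply]
  field_simp
  ring

theorem lt_one_of_logistic {Δ g y : ℝ → ℝ} {δ C : ℝ} (hδ : 0 < δ) (hΔ : ∀ t, δ ≤ Δ t)
    (hΔc : Continuous Δ) (hg : ∀ t, 0 < g t)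
    (hy : ∀ t, HasDerivAt y (Δ t * y t * (1 - y t) - g t) t) (hC : ∀ t, y t ≤ C) (s : ℝ) :
    y s < 1 := by
  by_contra! hs
  have hyc : Continuous y := continuous_iff_continuousAt.2 fun t => (hy t).continuousAt
  have hΔy : Continuous fun t => Δ t * y t := hΔc.mul hyc
  have hgt : ∀ t < s, 1 < y t := by
    have hd : ∀ t, HasDerivAt (fun t => (y t - 1) * Real.exp (∫ l in s..t, Δ l * y l))
        (-g t * Real.exp (∫ l in s..t, Δ l * y l)) t := fun t => by
      have hI : HasDerivAt (fun τ => ∫ l in s..τ, Δ l * y l) (Δ t * y t) t :=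
        (hΔy.integral_hasStrictDerivAt s t).hasDerivAt
      refine (((hy t).sub_const 1).mul hI.exp).congr_deriv ?_
      ring
    have hanti := strictAnti_of_deriv_neg (f := fun t =>
      (y t - 1) * Real.exp (∫ l in s..t, Δ l * y l)) fun t => by
        rw [(hd t).deriv]
        have := mul_pos (hg t) (Real.exp_pos (∫ l in s..t, Δ l * y l))
        linarith
    intro t ht
    have h := hanti ht
    simp only [intervalIntegral.integral_same, Real.exp_zero, mul_one] at h
    have := pos_of_mul_pos_left (lt_of_le_of_lt (sub_nonneg.2 hs) h) (Real.exp_pos _).le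
    linarith
  set η := y (s - 1) - 1 with hη
  have hηpos : 0 < η := by linarith [hgt (s - 1) (by linarith)]
  have hanti : AntitoneOn y (Iic (s - 1)) := by
    refine antitoneOn_of_deriv_nonpos (convex_Iic _) hyc.continuousOn
      (fun t _ => (hy t).differentiableAt.differentiableWithinAt) fun t ht => ?_
    rw [interior_Iic] at ht
    rw [(hy t).deriv]
    have h1 := hgt t (by linarith [mem_Iio.1 ht])
    have h2 : 0 ≤ Δ t * y t * (y t - 1) :=
      mul_nonneg (mul_nonneg (hδ.le.trans (hΔ t)) (by linarith)) (by linarith)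
    linarith [hg t]
  obtain ⟨t, ht, hlt⟩ := not_bddAbove_of_deriv_ge (m := fun t => y (-t))
    (m' := fun t => -(Δ (-t) * y (-t) * (1 - y (-t)) - g (-t))) (T := 1 - s)
    (mul_pos hδ hηpos)
    (fun t => ((hy (-t)).comp t (hasDerivAt_neg t)).congr_deriv (by ring))
    (fun t ht => by
      have h1 : η ≤ y (-t) - 1 := by
        have := hanti (show -t ∈ Iic (s - 1) by simp only [mem_Iic]; linarith)
          (show s - 1 ∈ Iic (s - 1) by simp) (by linarith)
        linarith
      have h2 : δ * 1 * η ≤ Δ (-t) * y (-t) * (y (-t) - 1) := by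
        have h3 : δ * 1 ≤ Δ (-t) * y (-t) :=
          mul_le_mul (hΔ _) (by linarith) zero_le_one (hδ.le.trans (hΔ _))
        exact mul_le_mul h3 h1 hηpos.le ((by linarith : (0 : ℝ) ≤ δ * 1).trans h3)
      linarith [hg (-t)]) C
  exact absurd (hC (-t)) (not_le.2 hlt)

theorem tendsto_zero_or_one_of_logistic {Δ g e G y : ℝ → ℝ} {δ K : ℝ} (hδ : 0 < δ)
    (hΔ : ∀ t, δ ≤ Δ t) (hg : ∀ t, 0 ≤ g t) (hge : ∀ t, g t ≤ e t)
    (hG : ∀ t, HasDerivAt G (e t) t) (hK : ∀ t, G t ≤ K)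
    (hy : ∀ t, HasDerivAt y (Δ t * y t * (1 - y t) - g t) t)
    (hy0 : ∀ t, 0 < y t) (hy1 : ∀ t, y t < 1) :
    Tendsto y atTop (nhds 0) ∨ Tendsto y atTop (nhds 1) := by
  have hlog : ∀ t, δ * (y t * (1 - y t)) ≤ Δ t * y t * (1 - y t) := fun t => by
    have h := mul_pos (hy0 t) (sub_pos.2 (hy1 t))
    nlinarith [hΔ t]
  have hlog0 : ∀ t, 0 ≤ δ * (y t * (1 - y t)) := fun t =>
    (mul_pos hδ (mul_pos (hy0 t) (sub_pos.2 (hy1 t)))).le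
  have hm : ∀ t, HasDerivAt (fun t => y t + G t) (Δ t * y t * (1 - y t) - g t + e t) t :=
    fun t => (hy t).add (hG t)
  have hmono : Monotone fun t => y t + G t :=
    monotone_of_deriv_nonneg (fun t => (hm t).differentiableAt) fun t => by
      rw [(hm t).deriv]
      linarith [hlog t, hlog0 t, hge t]
  have hGmono : Monotone G := monotone_of_deriv_nonneg (fun t => (hG t).differentiableAt)
    fun t => by rw [(hG t).deriv]; exact (hg t).trans (hge t)
  have hlim := (tendsto_atTop_ciSup hmono ⟨1 + K, by
    rintro _ ⟨t, rfl⟩; exact add_le_add (hy1 t).le (hK t)⟩).sub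
    (tendsto_atTop_ciSup hGmono ⟨K, by rintro _ ⟨t, rfl⟩; exact hK t⟩)
  simp only [add_sub_cancel_right] at hlim
  generalize (⨆ i, (y i + G i)) - ⨆ i, G i = L at hlim
  have hL0 : 0 ≤ L := ge_of_tendsto' hlim fun t => (hy0 t).le
  have hL1 : L ≤ 1 := le_of_tendsto' hlim fun t => (hy1 t).le
  rcases hL0.eq_or_lt with rfl | hL0
  · exact Or.inl hlim
  rcases hL1.eq_or_lt with rfl | hL1
  · exact Or.inr hlim
  exfalso
  have hη : 0 < δ * (L * (1 - L)) := mul_pos hδ (mul_pos hL0 (sub_pos.2 hL1))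
  have hlim' : Tendsto (fun t => δ * (y t * (1 - y t))) atTop (nhds (δ * (L * (1 - L)))) :=
    (hlim.mul (hlim.const_sub 1)).const_mul δ
  obtain ⟨T, hT⟩ := eventually_atTop.1 (hlim'.eventually (eventually_ge_nhds (half_lt_self hη)))
  obtain ⟨t, -, ht⟩ := not_bddAbove_of_deriv_ge (half_pos hη) hm
    (fun t ht => by linarith [hT t ht, hlog t, hge t]) (1 + K)
  linarith [hy1 t, hK t]

theorem hasDerivAt_sub_of_logistic {Δ g y₁ y₂ : ℝ → ℝ}
    (h₁ : ∀ t, HasDerivAt y₁ (Δ t * y₁ t * (1 - y₁ t) - g t) t)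
    (h₂ : ∀ t, HasDerivAt y₂ (Δ t * y₂ t * (1 - y₂ t) - g t) t) (t : ℝ) :
    HasDerivAt (fun τ => y₂ τ - y₁ τ) (Δ t * (y₂ t - y₁ t) * (1 - y₁ t - y₂ t)) t := by
  refine ((h₂ t).sub (h₁ t)).congr_deriv ?_
  ring

/-- The larger of two solutions of a perturbed logistic equation cannot decay to zero. -/
theorem not_tendsto_zero_of_logistic {Δ g y₁ y₂ : ℝ → ℝ} (hΔ : ∀ t, 0 < Δ t)
    (h₁ : ∀ t, HasDerivAt y₁ (Δ t * y₁ t * (1 - y₁ t) - g t) t)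
    (h₂ : ∀ t, HasDerivAt y₂ (Δ t * y₂ t * (1 - y₂ t) - g t) t)
    (hpos : ∀ t, 0 < y₁ t) (hlt : ∀ t, y₁ t < y₂ t) : ¬ Tendsto y₂ atTop (nhds 0) := by
  intro hlim
  have hd := hasDerivAt_sub_of_logistic h₁ h₂
  obtain ⟨T, hT⟩ := eventually_atTop.1
    (hlim.eventually (eventually_le_nhds (show (0 : ℝ) < 1 / 2 by norm_num)))
  have hmono : MonotoneOn (fun t => y₂ t - y₁ t) (Ici T) := by
    refine monotoneOn_of_deriv_nonneg (convex_Ici T)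
      (fun t _ => (hd t).continuousAt.continuousWithinAt)
      (fun t _ => (hd t).differentiableAt.differentiableWithinAt) fun t ht => ?_
    rw [interior_Ici] at ht
    rw [(hd t).deriv]
    have := hT t ht.le
    exact mul_nonneg (mul_nonneg (hΔ t).le (sub_pos.2 (hlt t)).le) (by linarith [hlt t])
  have hle : y₂ T - y₁ T ≤ 0 := ge_of_tendsto hlim <| by
    filter_upwards [eventually_ge_atTop T] with t ht
    have := hmono self_mem_Ici (show t ∈ Ici T from ht) ht
    simp only at this
    linarith [hpos t]
  linarith [hlt T]

/-- If two solutions of a perturbed logistic equation tend to one, their weighted difference is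
integrable at `∞`. -/
theorem exists_integral_le_of_logistic {Δ g y₁ y₂ : ℝ → ℝ} (hΔ : ∀ t, 0 < Δ t)
    (hΔc : Continuous Δ)
    (h₁ : ∀ t, HasDerivAt y₁ (Δ t * y₁ t * (1 - y₁ t) - g t) t)
    (h₂ : ∀ t, HasDerivAt y₂ (Δ t * y₂ t * (1 - y₂ t) - g t) t)
    (hlt : ∀ t, y₁ t < y₂ t) (hlim : Tendsto y₁ atTop (nhds 1)) :
    ∃ M, ∀ t, ∫ l in (0 : ℝ)..t, Δ l * (y₂ l - y₁ l) ≤ M := by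
  have hd := hasDerivAt_sub_of_logistic h₁ h₂
  have hzc : Continuous fun t => y₂ t - y₁ t :=
    continuous_iff_continuousAt.2 fun t => (hd t).continuousAt
  have hc : Continuous fun t => Δ t * (y₂ t - y₁ t) := hΔc.mul hzc
  have hnn : ∀ t, 0 < Δ t * (y₂ t - y₁ t) := fun t => mul_pos (hΔ t) (sub_pos.2 (hlt t))
  have hI : ∀ t, HasDerivAt (fun t => ∫ l in (0 : ℝ)..t, Δ l * (y₂ l - y₁ l))
      (Δ t * (y₂ t - y₁ t)) t := fun t =>
    (hc.integral_hasStrictDerivAt 0 t).hasDerivAt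
  have hImono : Monotone fun t => ∫ l in (0 : ℝ)..t, Δ l * (y₂ l - y₁ l) :=
    monotone_of_deriv_nonneg (fun t => (hI t).differentiableAt) fun t => by
      rw [(hI t).deriv]; exact (hnn t).le
  obtain ⟨T, hT⟩ := eventually_atTop.1
    (hlim.eventually (eventually_ge_nhds (show (3 / 4 : ℝ) < 1 by norm_num)))
  have hH : ∀ t, HasDerivAt
      (fun t => (∫ l in (0 : ℝ)..t, Δ l * (y₂ l - y₁ l)) + 2 * (y₂ t - y₁ t))
      (Δ t * (y₂ t - y₁ t) + 2 * (Δ t * (y₂ t - y₁ t) * (1 - y₁ t - y₂ t))) t := fun t =>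
    (hI t).add ((hd t).const_mul 2)
  have hanti : AntitoneOn
      (fun t => (∫ l in (0 : ℝ)..t, Δ l * (y₂ l - y₁ l)) + 2 * (y₂ t - y₁ t)) (Ici T) := by
    refine antitoneOn_of_deriv_nonpos (convex_Ici T)
      (fun t _ => (hH t).continuousAt.continuousWithinAt)
      (fun t _ => (hH t).differentiableAt.differentiableWithinAt) fun t ht => ?_
    rw [interior_Ici] at ht
    rw [(hH t).deriv]
    have := hT t ht.le
    nlinarith [hnn t, hlt t]
  refine ⟨(∫ l in (0 : ℝ)..T, Δ l * (y₂ l - y₁ l)) + 2 * (y₂ T - y₁ T), fun t => ?_⟩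
  rcases le_total T t with h | h
  · have := hanti self_mem_Ici (show t ∈ Ici T from h) h
    simp only at this
    linarith [hlt t]
  · have := hImono h
    simp only at this
    linarith [hlt T]

/-- An attractive and a repulsive hyperbolic solution are uniformly separated. -/
theorem exists_pos_le_sub_of_dich {p ta tr : ℝ → ℝ} {A B k₁ β₁ k₂ β₂ : ℝ}
    (ha : ∀ t, HasDerivAt ta (-(ta t) ^ 2 + p t) t) (hA : ∀ t, |ta t| ≤ A)
    (hr : ∀ t, HasDerivAt tr (-(tr t) ^ 2 + p t) t) (hB : ∀ t, |tr t| ≤ B)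
    (hlt : ∀ t, tr t < ta t) (hda : AttrDich (fun _ => 0) ta k₁ β₁)
    (hdr : RepDich (fun _ => 0) tr k₂ β₂) : ∃ δ > 0, ∀ t, δ ≤ ta t - tr t := by
  obtain ⟨hk₁, hβ₁, hda⟩ := hda
  obtain ⟨hk₂, hβ₂, hdr⟩ := hdr
  have hac : Continuous ta := continuous_iff_continuousAt.2 fun t => (ha t).continuousAt
  have hrc : Continuous tr := continuous_iff_continuousAt.2 fun t => (hr t).continuousAt
  have hk : 1 ≤ k₁ * k₂ := by nlinarith
  set T := (2 + Real.log (k₁ * k₂)) / (β₁ + β₂) with hT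
  have hTpos : 0 < T := div_pos (by linarith [Real.log_nonneg hk]) (by linarith)
  have hA0 : 0 ≤ A + B := by linarith [abs_nonneg (ta 0), hA 0, abs_nonneg (tr 0), hB 0]
  refine ⟨1 / (Real.exp ((A + B) * T) * T), by positivity, fun s => ?_⟩
  have h_int : 1 ≤ ∫ l in s..s + T, (ta l - tr l) := by
    have h1 := hda s (s + T) (by linarith)
    have h2 := hdr (s + T) s (by linarith)
    have h3 := mul_le_mul h1 h2 (Real.exp_pos _).le (by positivity)
    rw [← Real.exp_add, intervalIntegral.integral_symm s (s + T), ← sub_eq_add_neg,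
      ← intervalIntegral.integral_sub
        (Continuous.intervalIntegrable (by fun_prop) _ _)
        (Continuous.intervalIntegrable (by fun_prop) _ _)] at h3
    have h4 : ∫ l in s..s + T, ((-2 * ta l + 0) - (-2 * tr l + 0))
        = -2 * ∫ l in s..s + T, (ta l - tr l) := by
      rw [← intervalIntegral.integral_const_mul]
      congr 1
      ext l
      ring
    have h5 : k₁ * Real.exp (-β₁ * (s + T - s)) * (k₂ * Real.exp (β₂ * (s - (s + T))))
        = Real.exp (-2) := by
      have h6 : (β₁ + β₂) * T = 2 + Real.log (k₁ * k₂) := by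
        rw [hT]; field_simp
      calc _ = (k₁ * k₂) * Real.exp (-((β₁ + β₂) * T)) := by
            rw [mul_mul_mul_comm, ← Real.exp_add]; ring_nf
        _ = Real.exp (Real.log (k₁ * k₂)) * Real.exp (-((β₁ + β₂) * T)) := by
            rw [Real.exp_log (by linarith)]
        _ = _ := by rw [h6, ← Real.exp_add]; ring_nf
    rw [h4, h5, Real.exp_le_exp] at h3
    linarith
  have hbd : ∀ t ∈ Icc s (s + T), ta t - tr t ≤ (ta s - tr s) * Real.exp ((A + B) * T) := by
    intro t ht
    rw [eq_mul_exp_integral (g := fun t => -(ta t + tr t)) (by fun_prop)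
      (hasDerivAt_sub_of_riccati ha hr) s t]
    refine mul_le_mul_of_nonneg_left (Real.exp_le_exp.2 ?_) (sub_pos.2 (hlt s)).le
    have h1 := intervalIntegral.norm_integral_le_of_norm_le_const (a := s) (b := t)
      (f := fun l => -(ta l + tr l)) (C := A + B) fun l _ => by
        rw [norm_neg, Real.norm_eq_abs]
        exact (abs_add_le _ _).trans (add_le_add (hA l) (hB l))
    rw [Real.norm_eq_abs, abs_of_nonneg (sub_nonneg.2 ht.1)] at h1
    exact (le_abs_self _).trans (h1.trans (mul_le_mul_of_nonneg_left (by linarith [ht.2]) hA0))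
  have hle := intervalIntegral.integral_mono_on (μ := MeasureTheory.volume)
    (by linarith : s ≤ s + T) (f := fun l => ta l - tr l)
    (g := fun _ => (ta s - tr s) * Real.exp ((A + B) * T))
    ((hac.sub hrc).intervalIntegrable _ _) intervalIntegrable_const hbd
  rw [intervalIntegral.integral_const, smul_eq_mul, add_sub_cancel_left] at hle
  rw [div_le_iff₀ (by positivity)]
  calc 1 ≤ _ := h_int.trans hle
    _ = _ := by ring

/-- If the difference of two bounded solutions of a Riccati equation is integrable at `∞`, then
there is a bounded solution below both of them. -/
theorem exists_bdd_solution_lt {P a r : ℝ → ℝ} {A B M : ℝ}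
    (ha : ∀ t, HasDerivAt a (-(a t) ^ 2 + P t) t) (hA : ∀ t, |a t| ≤ A)
    (hr : ∀ t, HasDerivAt r (-(r t) ^ 2 + P t) t) (hB : ∀ t, |r t| ≤ B)
    (hlt : ∀ t, r t < a t) (hM : ∀ t, ∫ l in (0 : ℝ)..t, (a l - r l) ≤ M) :
    ∃ x : ℝ → ℝ, (∀ t, HasDerivAt x (-(x t) ^ 2 + P t) t) ∧ (∃ C, ∀ t, |x t| ≤ C) ∧
      ∀ t, x t < r t := by
  have hac : Continuous a := continuous_iff_continuousAt.2 fun t => (ha t).continuousAt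
  have hrc : Continuous r := continuous_iff_continuousAt.2 fun t => (hr t).continuousAt
  set ψ : ℝ → ℝ := fun t => Real.exp (∫ l in (0 : ℝ)..t, (a l - r l)) with hψ
  have hψ' : ∀ t, HasDerivAt ψ (ψ t * (a t - r t)) t := fun t =>
    ((hac.sub hrc).integral_hasStrictDerivAt 0 t).hasDerivAt.exp
  have hψ0 : ∀ t, 0 < ψ t := fun t => Real.exp_pos _
  have hψM : ∀ t, ψ t ≤ Real.exp M := fun t => Real.exp_le_exp.2 (hM t)
  set N := 2 * Real.exp M with hN
  have hden : ∀ t, 0 < N - ψ t := fun t => by linarith [hψM t, Real.exp_pos M]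
  refine ⟨fun t => r t - (a t - r t) * (ψ t / (N - ψ t)), fun t => ?_, ⟨B + (A + B), fun t => ?_⟩,
    fun t => ?_⟩
  · have hd : N - ψ t ≠ 0 := (hden t).ne'
    refine ((hr t).sub ((hasDerivAt_sub_of_riccati ha hr t).mul
      ((hψ' t).div ((hψ' t).const_sub N) hd))).congr_deriv ?_
    simp only [Pi.div_apply]
    field_simp
    ring
  · have h1 : 0 ≤ ψ t / (N - ψ t) := (div_pos (hψ0 t) (hden t)).le
    have h2 : ψ t / (N - ψ t) ≤ 1 := by
      rw [div_le_one (hden t)]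
      linarith [hψM t]
    refine (abs_sub _ _).trans (add_le_add (hB t) ?_)
    rw [abs_mul, abs_of_nonneg h1]
    have h3 : |a t - r t| ≤ A + B := (abs_sub _ _).trans (add_le_add (hA t) (hB t))
    nlinarith [abs_nonneg (a t - r t)]
  · have := mul_pos (sub_pos.2 (hlt t)) (div_pos (hψ0 t) (hden t))
    linarith

/-- For `p - q` with `q > 0`, bounded solutions lie below the upper solution for `p`. -/
theorem lt_of_bdd_solution {p q ta tr x : ℝ → ℝ} {δ C B : ℝ}
    (ha : ∀ t, HasDerivAt ta (-(ta t) ^ 2 + p t) t)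
    (hr : ∀ t, HasDerivAt tr (-(tr t) ^ 2 + p t) t) (hB : ∀ t, |tr t| ≤ B)
    (hδ : 0 < δ) (hsep : ∀ t, δ ≤ ta t - tr t) (hq : ∀ t, 0 < q t)
    (hx : ∀ t, HasDerivAt x (-(x t) ^ 2 + (p t - q t)) t) (hC : ∀ t, |x t| ≤ C) (t : ℝ) :
    x t < ta t := by
  have hlt : ∀ t, tr t < ta t := fun t => by linarith [hsep t]
  have hac : Continuous ta := continuous_iff_continuousAt.2 fun t => (ha t).continuousAt
  have hrc : Continuous tr := continuous_iff_continuousAt.2 fun t => (hr t).continuousAt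
  have h := lt_one_of_logistic (C := (C + B) / δ) hδ hsep (hac.sub hrc)
    (fun t => div_pos (hq t) (sub_pos.2 (hlt t))) (hasDerivAt_div_logistic hr ha hlt hx)
    (fun t => by
      have h1 : |x t - tr t| ≤ C + B := (abs_sub _ _).trans (add_le_add (hC t) (hB t))
      calc (x t - tr t) / (ta t - tr t) ≤ |x t - tr t| / (ta t - tr t) :=
            div_le_div_of_nonneg_right (le_abs_self _) (hδ.le.trans (hsep t))
        _ ≤ (C + B) / δ := div_le_div₀ ((abs_nonneg _).trans h1) h1 hδ (hsep t)) t
  rw [div_lt_one (sub_pos.2 (hlt t))] at h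
  linarith

/-- If `r < a` are bounded solutions for `p - q`, with `q` positive and integrable, lying strictly
between `tr` and `ta`, and no bounded solution goes below `r`, then `a` approaches `ta` and `r`
approaches `tr` at `∞`. -/
theorem tendsto_sub_atTop_of_minimal {p q G ta tr a r : ℝ → ℝ} {δ A B K : ℝ}
    (hta : ∀ t, HasDerivAt ta (-(ta t) ^ 2 + p t) t) (hA : ∀ t, |ta t| ≤ A)
    (htr : ∀ t, HasDerivAt tr (-(tr t) ^ 2 + p t) t) (hB : ∀ t, |tr t| ≤ B)
    (hδ : 0 < δ) (hsep : ∀ t, δ ≤ ta t - tr t)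
    (hq : ∀ t, 0 < q t) (hG : ∀ t, HasDerivAt G (q t) t) (hK : ∀ t, |G t| ≤ K)
    (ha : ∀ t, HasDerivAt a (-(a t) ^ 2 + (p t - q t)) t)
    (hr : ∀ t, HasDerivAt r (-(r t) ^ 2 + (p t - q t)) t)
    (htrr : ∀ t, tr t < r t) (hra : ∀ t, r t < a t) (hata : ∀ t, a t < ta t)
    (hmin : ∀ x : ℝ → ℝ, (∀ t, HasDerivAt x (-(x t) ^ 2 + (p t - q t)) t) →
      (∃ C, ∀ t, |x t| ≤ C) → ∀ t, r t ≤ x t) :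
    Tendsto (fun t => ta t - a t) atTop (nhds 0) ∧
      Tendsto (fun t => r t - tr t) atTop (nhds 0) := by
  have hlt : ∀ t, 0 < ta t - tr t := fun t => hδ.trans_le (hsep t)
  have hlt' : ∀ t, tr t < ta t := fun t => sub_pos.1 (hlt t)
  have htac : Continuous ta := continuous_iff_continuousAt.2 fun t => (hta t).continuousAt
  have htrc : Continuous tr := continuous_iff_continuousAt.2 fun t => (htr t).continuousAt
  set y₁ : ℝ → ℝ := fun t => (r t - tr t) / (ta t - tr t) with hy₁
  set y₂ : ℝ → ℝ := fun t => (a t - tr t) / (ta t - tr t) with hy₂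
  have h₁ := hasDerivAt_div_logistic htr hta hlt' hr
  have h₂ := hasDerivAt_div_logistic htr hta hlt' ha
  have hy₁0 : ∀ t, 0 < y₁ t := fun t => div_pos (by linarith [htrr t]) (hlt t)
  have hy₁₂ : ∀ t, y₁ t < y₂ t := fun t =>
    div_lt_div_of_pos_right (by linarith [hra t]) (hlt t)
  have hy₂1 : ∀ t, y₂ t < 1 := fun t => (div_lt_one (hlt t)).2 (by linarith [hata t])
  have hdich : ∀ y : ℝ → ℝ, (∀ t, HasDerivAt y
      ((ta t - tr t) * y t * (1 - y t) - q t / (ta t - tr t)) t) → (∀ t, 0 < y t) →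
      (∀ t, y t < 1) → Tendsto y atTop (nhds 0) ∨ Tendsto y atTop (nhds 1) := fun y hy h0 h1 =>
    tendsto_zero_or_one_of_logistic (e := fun t => q t / δ) (G := fun t => G t / δ) (K := K / δ)
      hδ hsep (fun t => (div_pos (hq t) (hlt t)).le)
      (fun t => div_le_div_of_nonneg_left (hq t).le hδ (hsep t)) (fun t => (hG t).div_const δ)
      (fun t => div_le_div_of_nonneg_right ((le_abs_self _).trans (hK t)) hδ.le) hy h0 h1
  have hlim₂ : Tendsto y₂ atTop (nhds 1) :=
    (hdich y₂ h₂ (fun t => (hy₁0 t).trans (hy₁₂ t)) hy₂1).resolve_left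
      (not_tendsto_zero_of_logistic hlt h₁ h₂ hy₁0 hy₁₂)
  have hlim₁ : Tendsto y₁ atTop (nhds 0) := by
    refine (hdich y₁ h₁ hy₁0 fun t => (hy₁₂ t).trans (hy₂1 t)).resolve_right fun h1 => ?_
    obtain ⟨M, hM⟩ := exists_integral_le_of_logistic hlt (htac.sub htrc) h₁ h₂ hy₁₂ h1
    have heq : ∀ t, (ta t - tr t) * (y₂ t - y₁ t) = a t - r t := fun t => by
      have := (hlt t).ne'
      simp only [hy₁, hy₂]
      field_simp
      ring
    have hM' : ∀ t, ∫ l in (0 : ℝ)..t, (a l - r l) ≤ M := fun t =>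
      (intervalIntegral.integral_congr fun l _ => (heq l).symm).trans_le (hM t)
    have hbd : ∀ x : ℝ → ℝ, (∀ t, tr t < x t) → (∀ t, x t < ta t) → ∀ t, |x t| ≤ A + B :=
      fun x h1 h2 t => abs_le.2
        ⟨by linarith [h1 t, (abs_le.1 (hB t)).1, (abs_nonneg (ta t)).trans (hA t)],
          by linarith [h2 t, (abs_le.1 (hA t)).2, (abs_nonneg (tr t)).trans (hB t)]⟩
    obtain ⟨x, hx, hxb, hxr⟩ := exists_bdd_solution_lt ha
      (hbd a (fun t => (htrr t).trans (hra t)) hata) hr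
      (hbd r htrr fun t => (hra t).trans (hata t)) hra hM'
    exact absurd (hmin x hx hxb 0) (not_le.2 (hxr 0))
  have hbdd : ∀ z : ℝ → ℝ, Tendsto z atTop (nhds 0) →
      Tendsto (fun t => z t * (ta t - tr t)) atTop (nhds 0) := fun z hz =>
    hz.zero_mul_isBoundedUnder_le (isBoundedUnder_of ⟨A + B, fun t => by
      simp only [Function.comp_apply, Real.norm_eq_abs]
      exact (abs_sub _ _).trans (add_le_add (hA t) (hB t))⟩)
  constructor
  · refine (hbdd (fun t => 1 - y₂ t) (by simpa using hlim₂.const_sub 1)).congr fun t => ?_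
    have := (hlt t).ne'
    simp only [hy₂]
    field_simp
    ring
  · refine (hbdd y₁ hlim₁).congr fun t => ?_
    have := (hlt t).ne'
    simp only [hy₁]
    field_simp

/-- The bounded solution operator of the linear equation `z' = D (h - z)`, where `E' = E D`. -/
noncomputable def relaxation (E D h : ℝ → ℝ) (t : ℝ) : ℝ :=
  (∫ s in Iic t, E s * D s * h s) / E t

section relaxation

variable {E D h : ℝ → ℝ} {H : ℝ}

theorem integrableOn_relaxation (hE : ∀ t, 0 < E t) (hD : ∀ t, 0 < D t)
    (hDc : Continuous D) (hE' : ∀ t, HasDerivAt E (E t * D t) t)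
    (hc : Continuous h) (hH : ∀ t, |h t| ≤ H) (t : ℝ) :
    MeasureTheory.IntegrableOn (fun s => E s * D s * h s) (Iic t) := by
  have hEc : Continuous E := continuous_iff_continuousAt.2 fun t => (hE' t).continuousAt
  have hH0 : 0 ≤ H := (abs_nonneg _).trans (hH 0)
  refine MeasureTheory.integrableOn_Iic_of_intervalIntegral_norm_bounded (l := atBot)
    (a := fun i => i) (H * E t) t (fun i => ?_) tendsto_id ?_
  · exact (((hEc.mul hDc).mul hc).integrableOn_Icc).mono_set Ioc_subset_Icc_self
  · filter_upwards [eventually_le_atBot t] with i hi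
    have h1 : ∫ s in i..t, ‖E s * D s * h s‖ ≤ ∫ s in i..t, H * (E s * D s) := by
      refine intervalIntegral.integral_mono_on hi
        (((hEc.mul hDc).mul hc).norm.intervalIntegrable _ _)
        (((hEc.mul hDc).const_mul H).intervalIntegrable _ _) fun s _ => ?_
      have h2 := mul_pos (hE s) (hD s)
      rw [norm_mul, Real.norm_eq_abs, Real.norm_eq_abs, abs_of_pos h2, mul_comm]
      exact mul_le_mul_of_nonneg_right (hH s) h2.le
    rw [intervalIntegral.integral_const_mul, intervalIntegral.integral_eq_sub_of_hasDerivAt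
      (fun s _ => hE' s) ((hEc.mul hDc).intervalIntegrable _ _)] at h1
    exact h1.trans (mul_le_mul_of_nonneg_left (by linarith [hE i]) hH0)

theorem abs_relaxation_le (hE : ∀ t, 0 < E t) (hD : ∀ t, 0 < D t)
    (hDc : Continuous D) (hE' : ∀ t, HasDerivAt E (E t * D t) t)
    (hE0 : Tendsto E atBot (nhds 0)) (hH : ∀ t, |h t| ≤ H) (t : ℝ) :
    |relaxation E D h t| ≤ H := by
  have h_int : MeasureTheory.IntegrableOn (fun s => E s * D s) (Iic t) := by
    simpa using integrableOn_relaxation (h := fun _ => 1) (H := 1) hE hD hDc hE'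
      continuous_const (by simp) t
  have hval := MeasureTheory.integral_Iic_of_hasDerivAt_of_tendsto' (fun s _ => hE' s) h_int hE0
  have h1 : ‖∫ s in Iic t, E s * D s * h s‖ ≤ ∫ s in Iic t, H * (E s * D s) := by
    refine MeasureTheory.norm_integral_le_of_norm_le (h_int.const_mul H)
      (Eventually.of_forall fun s => ?_)
    have h2 := mul_pos (hE s) (hD s)
    rw [norm_mul, Real.norm_eq_abs, Real.norm_eq_abs, abs_of_pos h2, mul_comm]
    exact mul_le_mul_of_nonneg_right (hH s) h2.le
  rw [MeasureTheory.integral_const_mul, hval, sub_zero] at h1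
  rw [relaxation, abs_div, abs_of_pos (hE t), div_le_iff₀ (hE t)]
  exact h1

theorem hasDerivAt_relaxation (hE : ∀ t, 0 < E t) (hD : ∀ t, 0 < D t)
    (hDc : Continuous D) (hE' : ∀ t, HasDerivAt E (E t * D t) t)
    (hc : Continuous h) (hH : ∀ t, |h t| ≤ H) (t : ℝ) :
    HasDerivAt (relaxation E D h) (D t * (h t - relaxation E D h t)) t := by
  have hEc : Continuous E := continuous_iff_continuousAt.2 fun t => (hE' t).continuousAt
  have h_int := integrableOn_relaxation hE hD hDc hE' hc hH
  have hfc : Continuous fun s => E s * D s * h s := (hEc.mul hDc).mul hc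
  have hI : HasDerivAt (fun t => ∫ s in Iic t, E s * D s * h s) (E t * D t * h t) t := by
    have heq : (fun t => ∫ s in Iic t, E s * D s * h s) =
        fun t => (∫ s in (0 : ℝ)..t, E s * D s * h s) + ∫ s in Iic (0 : ℝ), E s * D s * h s := by
      ext t
      rw [← intervalIntegral.integral_Iic_sub_Iic (h_int 0) (h_int t), sub_add_cancel]
    rw [heq]
    exact (hfc.integral_hasStrictDerivAt 0 t).hasDerivAt.add_const _
  refine (hI.div (hE' t) (hE t).ne').congr_deriv ?_
  have := (hE t).ne'
  rw [relaxation]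
  field_simp

theorem relaxation_sub {h₁ h₂ : ℝ → ℝ} {H₁ H₂ : ℝ} (hE : ∀ t, 0 < E t) (hD : ∀ t, 0 < D t)
    (hDc : Continuous D) (hE' : ∀ t, HasDerivAt E (E t * D t) t)
    (hc₁ : Continuous h₁) (hH₁ : ∀ t, |h₁ t| ≤ H₁)
    (hc₂ : Continuous h₂) (hH₂ : ∀ t, |h₂ t| ≤ H₂) (t : ℝ) :
    relaxation E D h₁ t - relaxation E D h₂ t = relaxation E D (fun s => h₁ s - h₂ s) t := by
  rw [relaxation, relaxation, relaxation, ← sub_div, ← MeasureTheory.integral_sub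
    (integrableOn_relaxation hE hD hDc hE' hc₁ hH₁ t)
    (integrableOn_relaxation hE hD hDc hE' hc₂ hH₂ t)]
  simp only [mul_sub]

end relaxation

/-- The truncation of a real number to `[-1/4, 1/4]`. -/
noncomputable def clampQuarter (x : ℝ) : ℝ := max (-1 / 4) (min x (1 / 4))

theorem abs_clampQuarter_le (x : ℝ) : |clampQuarter x| ≤ 1 / 4 :=
  abs_le.2 ⟨by have := le_max_left (-1 / 4) (min x (1 / 4)); rw [clampQuarter]; linarith,
    max_le (by norm_num) (min_le_right _ _)⟩

theorem clampQuarter_of_abs_le {x : ℝ} (hx : |x| ≤ 1 / 4) : clampQuarter x = x := by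
  rw [clampQuarter, min_eq_left (abs_le.1 hx).2, max_eq_right]
  linarith [(abs_le.1 hx).1]

theorem continuous_clampQuarter : Continuous clampQuarter := by
  unfold clampQuarter
  fun_prop

theorem abs_clampQuarter_sq_sub_le (x y : ℝ) :
    |clampQuarter x ^ 2 - clampQuarter y ^ 2| ≤ 1 / 2 * |x - y| := by
  have h1 : |clampQuarter x - clampQuarter y| ≤ |x - y| := by
    simpa [Real.dist_eq, clampQuarter] using
      ((LipschitzWith.id.min_const (1 / 4 : ℝ)).const_max (-1 / 4)).dist_le_mul x y
  have h2 : |clampQuarter x + clampQuarter y| ≤ 1 / 2 :=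
    (abs_add_le _ _).trans (by linarith [abs_clampQuarter_le x, abs_clampQuarter_le y])
  rw [sq_sub_sq, abs_mul]
  exact mul_le_mul h2 h1 (abs_nonneg _) (by norm_num)

open BoundedContinuousFunction in
theorem exists_bdd_solution_of_small {D : ℝ → ℝ} {δ ε : ℝ} (hδ : 0 < δ) (hD : ∀ t, δ ≤ D t)
    (hDc : Continuous D) (hε0 : 0 ≤ ε) (hε : ε / δ ^ 2 ≤ 1 / 8) :
    ∃ w : ℝ → ℝ, (∀ t, |w t| ≤ 1 / 4) ∧
      ∀ t, HasDerivAt w (-(D t * w t) - D t * w t ^ 2 - ε / D t) t := by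
  have hD0 : ∀ t, 0 < D t := fun t => hδ.trans_le (hD t)
  set E : ℝ → ℝ := fun t => Real.exp (∫ s in (0 : ℝ)..t, D s) with hEdef
  have hE : ∀ t, 0 < E t := fun t => Real.exp_pos _
  have hE' : ∀ t, HasDerivAt E (E t * D t) t := fun t =>
    (hDc.integral_hasStrictDerivAt 0 t).hasDerivAt.exp
  have hE0 : Tendsto E atBot (nhds 0) := by
    refine Real.tendsto_exp_atBot.comp
      (tendsto_atBot_mono' _ ?_ (tendsto_id.const_mul_atBot hδ))
    filter_upwards [eventually_le_atBot (0 : ℝ)] with t ht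
    have h := intervalIntegral.integral_mono_on (μ := MeasureTheory.volume) ht
      (f := fun _ => δ) intervalIntegrable_const (hDc.intervalIntegrable _ _) fun s _ => hD s
    rw [intervalIntegral.integral_const, smul_eq_mul] at h
    rw [intervalIntegral.integral_symm, id]
    linarith
  let src : (ℝ → ℝ) → ℝ → ℝ := fun f t => clampQuarter (f t) ^ 2 + ε / D t ^ 2
  have hsrcc : ∀ f : ℝ → ℝ, Continuous f → Continuous (src f) := fun f hf =>
    ((continuous_clampQuarter.comp hf).pow 2).add
      (continuous_const.div (hDc.pow 2) fun t => (pow_pos (hD0 t) 2).ne')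
  have hsrc : ∀ f t, |src f t| ≤ 1 / 4 := fun f t => by
    have h1 : clampQuarter (f t) ^ 2 ≤ (1 / 4) ^ 2 :=
      sq_le_sq' (by linarith [(abs_le.1 (abs_clampQuarter_le (f t))).1])
        (abs_le.1 (abs_clampQuarter_le (f t))).2
    have h2 : ε / D t ^ 2 ≤ ε / δ ^ 2 :=
      div_le_div_of_nonneg_left hε0 (by positivity) (pow_le_pow_left₀ hδ.le (hD t) 2)
    have h3 : 0 ≤ ε / D t ^ 2 := by positivity
    rw [abs_of_nonneg (by positivity)]
    simp only [src]
    linarith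
  have hder := fun (f : ℝ →ᵇ ℝ) =>
    hasDerivAt_relaxation hE hD0 hDc hE' (hsrcc f f.continuous) (hsrc f)
  let Φ : (ℝ →ᵇ ℝ) → (ℝ →ᵇ ℝ) := fun f => BoundedContinuousFunction.ofNormedAddCommGroup
    (fun t => -relaxation E D (src f) t)
    (continuous_iff_continuousAt.2 fun t => (hder f t).continuousAt.neg) (1 / 4) fun t => by
      rw [norm_neg]
      exact abs_relaxation_le hE hD0 hDc hE' hE0 (hsrc f) t
  have hΦ : ∀ f t, Φ f t = -relaxation E D (src f) t := fun f t => rfl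
  have hcontr : ContractingWith (1 / 2) Φ := by
    refine ⟨by norm_num, LipschitzWith.of_dist_le_mul fun f g => ?_⟩
    rw [BoundedContinuousFunction.dist_le (by positivity)]
    intro t
    rw [hΦ, hΦ, dist_neg_neg, Real.dist_eq, relaxation_sub hE hD0 hDc hE' (hsrcc f f.continuous)
      (hsrc f) (hsrcc g g.continuous) (hsrc g)]
    refine abs_relaxation_le hE hD0 hDc hE' hE0 (fun s => ?_) t
    simp only [src, add_sub_add_right_eq_sub]
    refine (abs_clampQuarter_sq_sub_le _ _).trans ?_
    have := f.dist_coe_le_dist (g := g) s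
    rw [Real.dist_eq] at this
    push_cast
    linarith
  set w := ContractingWith.fixedPoint Φ hcontr with hw
  have hfix : ∀ t, w t = -relaxation E D (src w) t := fun t => by
    conv_lhs => rw [hw, ← hcontr.fixedPoint_isFixedPt, ← hw]
    rw [hΦ]
  have hw4 : ∀ t, |w t| ≤ 1 / 4 := fun t => by
    rw [hfix, abs_neg]
    exact abs_relaxation_le hE hD0 hDc hE' hE0 (hsrc w) t
  refine ⟨w, hw4, fun t => ?_⟩
  have h := (hder w t).neg
  have heq : (-relaxation E D (src w)) = w := funext fun t => (hfix t).symm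
  rw [heq] at h
  refine h.congr_deriv ?_
  have h1 : relaxation E D (src w) t = -w t := by rw [hfix, neg_neg]
  have := (hD0 t).ne'
  rw [h1]
  simp only [src, clampQuarter_of_abs_le (hw4 t)]
  field_simp
  ring

/-- Uniformly separated bounded solutions of a Riccati equation persist under a small decrease of
the forcing term. -/
theorem exists_bdd_solution_sub {P a r : ℝ → ℝ} {A B δ ε : ℝ}
    (ha : ∀ t, HasDerivAt a (-(a t) ^ 2 + P t) t) (hA : ∀ t, |a t| ≤ A)
    (hr : ∀ t, HasDerivAt r (-(r t) ^ 2 + P t) t) (hB : ∀ t, |r t| ≤ B)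
    (hδ : 0 < δ) (hsep : ∀ t, δ ≤ a t - r t) (hε0 : 0 ≤ ε) (hε : ε / δ ^ 2 ≤ 1 / 8) :
    ∃ x : ℝ → ℝ, (∀ t, HasDerivAt x (-(x t) ^ 2 + (P t - ε)) t) ∧ ∃ C, ∀ t, |x t| ≤ C := by
  have hac : Continuous a := continuous_iff_continuousAt.2 fun t => (ha t).continuousAt
  have hrc : Continuous r := continuous_iff_continuousAt.2 fun t => (hr t).continuousAt
  obtain ⟨w, hw, hw'⟩ := exists_bdd_solution_of_small hδ hsep (hac.sub hrc) hε0 hε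
  refine ⟨fun t => a t + (a t - r t) * w t, fun t => ?_, A + (A + B) * (1 / 4), fun t => ?_⟩
  · refine ((ha t).add ((hasDerivAt_sub_of_riccati ha hr t).mul (hw' t))).congr_deriv ?_
    have : a t - r t ≠ 0 := (hδ.trans_le (hsep t)).ne'
    field_simp
    ring
  · have h1 : |a t - r t| ≤ A + B := (abs_sub _ _).trans (add_le_add (hA t) (hB t))
    refine (abs_add_le _ _).trans (add_le_add (hA t) ?_)
    rw [abs_mul]
    exact mul_le_mul h1 (hw t) (abs_nonneg _) ((abs_nonneg _).trans h1)

theorem attrDich_of_separated {P a r : ℝ → ℝ} {M δ : ℝ}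
    (ha : ∀ t, HasDerivAt a (-(a t) ^ 2 + P t) t) (hr : ∀ t, HasDerivAt r (-(r t) ^ 2 + P t) t)
    (hδ : 0 < δ) (hsep : ∀ t, δ ≤ a t - r t) (hM : ∀ t, a t - r t ≤ M) :
    AttrDich (fun _ => 0) a (M / δ) δ := by
  have hac : Continuous a := continuous_iff_continuousAt.2 fun t => (ha t).continuousAt
  have hrc : Continuous r := continuous_iff_continuousAt.2 fun t => (hr t).continuousAt
  refine ⟨(one_le_div hδ).2 ((hsep 0).trans (hM 0)), hδ, fun s t hst => ?_⟩
  have h1 := eq_mul_exp_integral (z := fun t => a t - r t)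
    (g := fun t => (-2 * a t + 0) + (a t - r t)) (by fun_prop)
    (fun t => (hasDerivAt_sub_of_riccati ha hr t).congr_deriv (by ring)) s t
  rw [intervalIntegral.integral_add (Continuous.intervalIntegrable (by fun_prop) _ _)
    (Continuous.intervalIntegrable (by fun_prop) _ _), Real.exp_add] at h1
  have h2 := intervalIntegral.integral_mono_on (μ := MeasureTheory.volume) hst (f := fun _ => δ)
    intervalIntegrable_const ((hac.sub hrc).intervalIntegrable _ _) fun l _ => hsep l
  rw [intervalIntegral.integral_const, smul_eq_mul] at h2
  have h3 : δ * (Real.exp (∫ l in s..t, (-2 * a l + 0)) * Real.exp ((t - s) * δ)) ≤ M := by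
    refine le_trans ?_ (h1 ▸ hM t)
    have := (hδ.trans_le (hsep s)).le
    gcongr
    exacts [hsep s, h2]
  rw [show -δ * (t - s) = -((t - s) * δ) by ring, Real.exp_neg, ← div_eq_mul_inv,
    le_div_iff₀ (Real.exp_pos _), le_div_iff₀ hδ]
  linarith

theorem repDich_of_separated {P a r : ℝ → ℝ} {M δ : ℝ}
    (ha : ∀ t, HasDerivAt a (-(a t) ^ 2 + P t) t) (hr : ∀ t, HasDerivAt r (-(r t) ^ 2 + P t) t)
    (hδ : 0 < δ) (hsep : ∀ t, δ ≤ a t - r t) (hM : ∀ t, a t - r t ≤ M) :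
    RepDich (fun _ => 0) r (M / δ) δ := by
  obtain ⟨h1, h2, h⟩ := attrDich_of_separated (P := fun t => P (-t)) (a := fun t => -r (-t))
    (r := fun t => -a (-t)) (M := M) (δ := δ) (hasDerivAt_neg_comp_neg_of_riccati hr)
    (hasDerivAt_neg_comp_neg_of_riccati ha) hδ (fun t => by linarith [hsep (-t)])
    (fun t => by linarith [hM (-t)])
  refine ⟨h1, h2, fun s t hts => ?_⟩
  have h3 := h (-s) (-t) (neg_le_neg hts)
  have h4 : ∫ l in (-s)..(-t), (-2 * -r (-l) + 0) = ∫ l in s..t, (-2 * r l + 0) := by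
    have h5 := intervalIntegral.integral_comp_neg (a := -s) (b := -t)
      (fun l => -2 * -r l + 0)
    rw [h5, neg_neg, neg_neg, intervalIntegral.integral_symm, ← intervalIntegral.integral_neg]
    congr 1
    ext l
    ring
  rw [h4] at h3
  convert h3 using 3
  ring

/-- A continuous positive function which is bounded away from zero near `±∞` is bounded away from
zero. -/
theorem exists_pos_le_of_eventually {D : ℝ → ℝ} {δ : ℝ} (hc : Continuous D) (hD : ∀ t, 0 < D t)
    (hδ : 0 < δ) (htop : ∀ᶠ t in atTop, δ ≤ D t) (hbot : ∀ᶠ t in atBot, δ ≤ D t) :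
    ∃ η > 0, ∀ t, η ≤ D t := by
  obtain ⟨T, hT⟩ := eventually_atTop.1 htop
  obtain ⟨S, hS⟩ := eventually_atBot.1 hbot
  obtain ⟨m, -, hm⟩ := isCompact_Icc.exists_isMinOn (s := Icc (min S T) T)
    ⟨T, min_le_right _ _, le_rfl⟩ hc.continuousOn
  refine ⟨min δ (D m), lt_min hδ (hD m), fun t => ?_⟩
  rcases le_total T t with h | h
  · exact (min_le_left _ _).trans (hT t h)
  rcases le_total t S with h' | h'
  · exact (min_le_left _ _).trans (hS t h')
  · exact (min_le_right _ _).trans (hm ⟨(min_le_left _ _).trans h', h⟩)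

theorem hasDerivAt_arctan_qc {c : ℝ} (t : ℝ) :
    HasDerivAt (fun t => 2 / Real.pi * Real.arctan (c * t)) (qc c t) t := by
  refine ((((hasDerivAt_id t).const_mul c).arctan).const_mul (2 / Real.pi)).congr_deriv ?_
  have h1 : 1 + (c * t) ^ 2 ≠ 0 := by positivity
  have h2 : c ^ 2 * t ^ 2 + 1 ≠ 0 := by positivity
  have := Real.pi_ne_zero
  simp only [qc, id]
  field_simp
  ring

theorem abs_arctan_mul_le (c t : ℝ) : |2 / Real.pi * Real.arctan (c * t)| ≤ 1 := by
  have hpi := Real.pi_pos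
  have h : |Real.arctan (c * t)| ≤ Real.pi / 2 := abs_le.2
    ⟨(Real.neg_pi_div_two_lt_arctan _).le, (Real.arctan_lt_pi_div_two _).le⟩
  rw [abs_mul, abs_of_pos (by positivity : 0 < 2 / Real.pi)]
  calc 2 / Real.pi * |Real.arctan (c * t)| ≤ 2 / Real.pi * (Real.pi / 2) := by gcongr
    _ = 1 := by field_simp

theorem isBddSol_zero_iff {P b : ℝ → ℝ} : IsBddSol (fun _ => 0) P b ↔
    (∀ t, HasDerivAt b (-(b t) ^ 2 + P t) t) ∧ ∃ C, ∀ t, |b t| ≤ C := by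
  simp [IsBddSol, quadF]

theorem mem_Icc_of_char {f : ℝ → ℝ → ℝ} {F : MaxSolFamily f} {a r b : ℝ → ℝ}
    (ha : CharA F a) (hr : CharR F r) (hb : ∀ t, HasDerivAt b (f t (b t)) t)
    (hbd : ∃ C, ∀ t, |b t| ≤ C) (s : ℝ) : b s ∈ Icc (r s) (a s) := by
  obtain ⟨C, hC⟩ := hbd
  obtain ⟨h1, h2⟩ := F.maximal s (b s) b univ isOpen_univ ordConnected_univ trivial rfl
    fun t _ => hb t
  have h : ∀ t, t ∈ F.dom s (b s) ∧ |F.X t s (b s)| ≤ C :=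
    fun t => ⟨h1 trivial, h2 t trivial ▸ hC t⟩
  exact ⟨(hr.2.2 s (b s)).1 ⟨C, Eventually.of_forall h⟩,
    (ha.2.2 s (b s)).1 ⟨C, Eventually.of_forall h⟩⟩

theorem stmt18 (p : ℝ → ℝ)
    (hpb : ∃ C, ∀ t, |p t| ≤ C) (hpu : UniformContinuous p)
    -- Hypothesis: x' = −x² + p(t) has exactly two hyperbolic solutions ã and r̃, r̃ < ã
    (ta tr : ℝ → ℝ)
    (hta : IsAttrHyp (fun _ => 0) p ta) (htr : IsRepHyp (fun _ => 0) p tr)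
    (htrta : ∀ t, tr t < ta t)
    (honly : ∀ b : ℝ → ℝ, IsHyp (fun _ => 0) p b → b = ta ∨ b = tr)
    (c : ℝ) (hc : 0 < c)
    (F : MaxSolFamily (quadF (fun _ => 0) (fun t => p t - qc c t)))
    -- a_c and r_c are ASSUMED globally defined and bounded
    (ac rc : ℝ → ℝ) (hac : CharA F ac) (hrc : CharR F rc)
    -- λ*(0, p − q_c)
    (lamstar : ℝ)
    (hstar : ∀ lam : ℝ,
      (∃ b : ℝ → ℝ, IsBddSol (fun _ => 0) (fun t => p t - qc c t + lam) b) ↔ lamstar ≤ lam) :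
    -- r̃ < r_c ≤ a_c < ã
    (∀ t, tr t < rc t ∧ rc t ≤ ac t ∧ ac t < ta t) ∧
    -- if moreover a_c ≠ r_c :
    (ac ≠ rc →
      Filter.Tendsto (fun t => ta t - ac t) atTop (nhds 0) ∧
      Filter.Tendsto (fun t => tr t - rc t) atBot (nhds 0) ∧
      (∃ δ > (0:ℝ), ∀ t, δ ≤ ac t - rc t) ∧
      IsHyp (fun _ => 0) (fun t => p t - qc c t) ac ∧
      IsHyp (fun _ => 0) (fun t => p t - qc c t) rc ∧
      lamstar < 0) ∧
    -- consequently, if λ*(0, p − q_c) = 0 there is exactly one bounded solution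
    (lamstar = 0 → ∃! b : ℝ → ℝ, IsBddSol (fun _ => 0) (fun t => p t - qc c t) b) := by
  have hq : ∀ t, 0 < qc c t := fun t => by
    have := Real.pi_pos
    unfold qc
    positivity
  have hG := hasDerivAt_arctan_qc (c := c)
  have hGb := abs_arctan_mul_le c
  obtain ⟨hta, k₁, β₁, hda⟩ := hta
  obtain ⟨htr, k₂, β₂, hdr⟩ := htr
  obtain ⟨hta, A, hA⟩ := isBddSol_zero_iff.1 hta
  obtain ⟨htr, B, hB⟩ := isBddSol_zero_iff.1 htr
  obtain ⟨δ, hδ, hsep⟩ := exists_pos_le_sub_of_dich hta hA htr hB htrta hda hdr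
  obtain ⟨hac', Ca, hCa⟩ := isBddSol_zero_iff.1 ⟨hac.1, hac.2.1⟩
  obtain ⟨hrc', Cr, hCr⟩ := isBddSol_zero_iff.1 ⟨hrc.1, hrc.2.1⟩
  have hmem : ∀ b : ℝ → ℝ, IsBddSol (fun _ => 0) (fun t => p t - qc c t) b →
      ∀ t, b t ∈ Icc (rc t) (ac t) := fun b hb t => mem_Icc_of_char hac hrc hb.1 hb.2 t
  have hle : ∀ t, rc t ≤ ac t := fun t => (hmem ac ⟨hac.1, hac.2.1⟩ t).1
  have htaR := hasDerivAt_neg_comp_neg_of_riccati hta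
  have htrR := hasDerivAt_neg_comp_neg_of_riccati htr
  have hacR := hasDerivAt_neg_comp_neg_of_riccati hac'
  have hrcR := hasDerivAt_neg_comp_neg_of_riccati hrc'
  have hsepR : ∀ t, δ ≤ -tr (-t) - -ta (-t) := fun t => by linarith [hsep (-t)]
  have hup : ∀ t, ac t < ta t := lt_of_bdd_solution hta htr hB hδ hsep hq hac' hCa
  have hlow : ∀ t, tr t < rc t := fun t => by
    have h := lt_of_bdd_solution htrR htaR (fun t => (abs_neg _).trans_le (hA (-t))) hδ hsepR
      (fun t => hq (-t)) hrcR (fun t => (abs_neg _).trans_le (hCr (-t))) (-t)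
    simpa using h
  have hmain : ac ≠ rc →
      Filter.Tendsto (fun t => ta t - ac t) atTop (nhds 0) ∧
      Filter.Tendsto (fun t => tr t - rc t) atBot (nhds 0) ∧
      (∃ δ > (0:ℝ), ∀ t, δ ≤ ac t - rc t) ∧
      IsHyp (fun _ => 0) (fun t => p t - qc c t) ac ∧
      IsHyp (fun _ => 0) (fun t => p t - qc c t) rc ∧
      lamstar < 0 := by
    intro hne
    have hcac : Continuous ac := continuous_iff_continuousAt.2 fun t => (hac' t).continuousAt
    have hcrc : Continuous rc := continuous_iff_continuousAt.2 fun t => (hrc' t).continuousAt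
    have hlt : ∀ t, rc t < ac t := by
      obtain ⟨s, hs⟩ := Function.ne_iff.1 hne
      have hs' : 0 < ac s - rc s := sub_pos.2 (lt_of_le_of_ne (hle s) hs.symm)
      intro t
      have h := eq_mul_exp_integral (g := fun t => -(ac t + rc t)) (by fun_prop)
        (hasDerivAt_sub_of_riccati hac' hrc') s t
      have : 0 < ac t - rc t := h ▸ mul_pos hs' (Real.exp_pos _)
      linarith
    obtain ⟨htop₁, htop₂⟩ := tendsto_sub_atTop_of_minimal hta hA htr hB hδ hsep hq hG hGb
      hac' hrc' hlow hlt hup fun x hx hxb t => (hmem x (isBddSol_zero_iff.2 ⟨hx, hxb⟩) t).1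
    obtain ⟨hbot₁, hbot₂⟩ := tendsto_sub_atTop_of_minimal (p := fun t => p (-t))
      (q := fun t => qc c (-t)) (G := fun t => -(2 / Real.pi * Real.arctan (c * -t))) (K := 1)
      htrR (fun t => (abs_neg _).trans_le (hB (-t)))
      htaR (fun t => (abs_neg _).trans_le (hA (-t))) hδ hsepR
      (fun t => hq (-t))
      (fun t => (((hG (-t)).comp t (hasDerivAt_neg t)).neg).congr_deriv (by ring))
      (fun t => (abs_neg _).trans_le (hGb (-t))) hrcR hacR
      (fun t => neg_lt_neg (hup (-t))) (fun t => neg_lt_neg (hlt (-t)))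
      (fun t => neg_lt_neg (hlow (-t))) fun x hx hxb t => by
        have h := hasDerivAt_neg_comp_neg_of_riccati hx
        simp only [neg_neg] at h
        obtain ⟨C, hC⟩ := hxb
        have h2 := (hmem _ (isBddSol_zero_iff.2
          ⟨h, C, fun t => (abs_neg _).trans_le (hC (-t))⟩) (-t)).2
        simp only [neg_neg] at h2
        linarith
    have hbot₁' : Tendsto (fun t => tr t - rc t) atBot (nhds 0) := by
      have h := (hbot₁.comp tendsto_neg_atBot_atTop).neg
      refine (neg_zero (G := ℝ) ▸ h).congr fun t => ?_
      simp only [Function.comp_apply, neg_neg]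
      ring
    have hbot₂' : Tendsto (fun t => ta t - ac t) atBot (nhds 0) := by
      refine (hbot₂.comp tendsto_neg_atBot_atTop).congr fun t => ?_
      simp only [Function.comp_apply, neg_neg]
      ring
    obtain ⟨η, hη, hηle⟩ := exists_pos_le_of_eventually (D := fun t => ac t - rc t)
      (hcac.sub hcrc) (fun t => sub_pos.2 (hlt t)) (half_pos hδ)
      (by
        filter_upwards [htop₁.eventually (eventually_le_nhds (show 0 < δ / 4 by positivity)),
          htop₂.eventually (eventually_le_nhds (show 0 < δ / 4 by positivity))] with t h1 h2
        linarith [hsep t])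
      (by
        filter_upwards [hbot₂'.eventually (eventually_le_nhds (show 0 < δ / 4 by positivity)),
          hbot₁'.eventually (eventually_ge_nhds (show -(δ / 4) < 0 by linarith))] with t h1 h2
        linarith [hsep t])
    have hM : ∀ t, ac t - rc t ≤ Ca + Cr := fun t =>
      (le_abs_self _).trans ((abs_sub _ _).trans (add_le_add (hCa t) (hCr t)))
    refine ⟨htop₁, hbot₁', ⟨η, hη, hηle⟩,
      Or.inl ⟨⟨hac.1, hac.2.1⟩, _, _, attrDich_of_separated hac' hrc' hη hηle hM⟩,
      Or.inr ⟨⟨hrc.1, hrc.2.1⟩, _, _, repDich_of_separated hac' hrc' hη hηle hM⟩, ?_⟩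
    obtain ⟨x, hx, hxb⟩ := exists_bdd_solution_sub (ε := η ^ 2 / 8) hac' hCa hrc' hCr hη hηle
      (by positivity) (le_of_eq (by field_simp))
    have h := (hstar (-(η ^ 2 / 8))).1 ⟨x, isBddSol_zero_iff.2 ⟨hx, hxb⟩⟩
    have : 0 < η ^ 2 / 8 := by positivity
    linarith
  refine ⟨fun t => ⟨hlow t, hle t, hup t⟩, hmain, fun h0 => ?_⟩
  have heq : ac = rc := by
    by_contra hne
    exact (hmain hne).2.2.2.2.2.ne h0
  refine ⟨ac, ⟨hac.1, hac.2.1⟩, fun b hb => funext fun t => ?_⟩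
  have h := hmem b hb t
  rw [← heq] at h
  exact le_antisymm h.2 h.1
end
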